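/- arXiv:1906.05556 — 2 statements merged into one kernel-verified Lean document; each statement's English description precedes it below -/
import Mathlib

section
/- Consider the Coxian distributed SEIR model with constant contact rate: differentiable functions S, E_n, ..., E_1, I, R : [0,∞) → ℝ satisfying S' = μ − β̄·S·I − μ·S, E_n' = β̄·S·I − (λ_n+μ)·E_n, E_i' = p̄_i·λ_{i+1}·E_{i+1} − (λ_i+μ)·E_i for i = n−1,...,1, I' = Σ_{i=0}^{n−1} p_i·λ_{i+1}·E_{i+1} − (γ+μ)·I, and R' = γ·I − μ·R. If R_0 ≤ 1 and the initial data are nonnegative with S(0) + Σ_{j=1}^n E_j(0) + I(0) + R(0) = 1, then the solution converges to the disease-free equilibrium: S(t) → 1, E_i(t) → 0 for every i, I(t) → 0, and R(t) → 0 as t → ∞. -/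
open Filter Topology

lemma cx_min_sq (y : ℝ) : HasDerivAt (fun y : ℝ => (min y 0)^2) (2 * min y 0) y := by
  have key : ∀ y : ℝ, y ≠ 0 → HasDerivAt (fun y : ℝ => (min y 0)^2) (2 * min y 0) y := by
    intro y hy
    rcases lt_or_gt_of_ne hy with h | h
    · have h1 : HasDerivAt (fun y : ℝ => y^2) (2 * min y 0) y := by
        rw [min_eq_left h.le]; simpa using hasDerivAt_pow 2 y
      refine h1.congr_of_eventuallyEq ?_
      filter_upwards [Iio_mem_nhds h] with z hz
      rw [min_eq_left (le_of_lt hz)]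
    · have h1 : HasDerivAt (fun _ : ℝ => (0:ℝ)) (2 * min y 0) y := by
        rw [min_eq_right h.le]; simpa using hasDerivAt_const y (0:ℝ)
      refine h1.congr_of_eventuallyEq ?_
      filter_upwards [Ioi_mem_nhds h] with z hz
      rw [min_eq_right (le_of_lt hz)]; simp
  rcases eq_or_ne y 0 with rfl | hy
  · exact hasDerivAt_of_hasDerivAt_of_ne (f := fun y : ℝ => (min y 0)^2)
      (g := fun y => 2 * min y 0) (x := 0) key (by fun_prop) (by fun_prop)
  · exact key y hy

lemma cx_antitone (T : ℝ) (f f' : ℝ → ℝ) (D : Set ℝ) (hD : Convex ℝ D)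
    (hf : ∀ t ∈ D, HasDerivAt f (f' t) t) (h : ∀ t ∈ D, f' t ≤ 0) : AntitoneOn f D := by
  refine antitoneOn_of_hasDerivWithinAt_nonpos (f' := f') hD
    (fun t ht => (hf t ht).continuousAt.continuousWithinAt)
    (fun t ht => (hf t (interior_subset ht)).hasDerivWithinAt)
    (fun t ht => h t (interior_subset ht))

lemma cx_nonneg {ι : Type*} (s : Finset ι) (x : ι → ℝ → ℝ) (T : ℝ)
    (h0 : ∀ i ∈ s, 0 ≤ x i 0)
    (h : ∀ i ∈ s, ∃ (d : ℝ → ℝ) (C : ℝ), (∀ t, 0 ≤ t → HasDerivAt (x i) (d t) t) ∧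
      ∀ t ∈ Set.Icc 0 T, min (x i t) 0 * d t ≤ C * ∑ j ∈ s, (min (x j t) 0)^2) :
    ∀ i ∈ s, ∀ t ∈ Set.Icc 0 T, 0 ≤ x i t := by
  classical
  choose! d C hd hC using h
  set V : ℝ → ℝ := fun t => ∑ j ∈ s, (min (x j t) 0)^2 with hV
  have hVd : ∀ t, 0 ≤ t → HasDerivAt V (∑ j ∈ s, 2 * min (x j t) 0 * d j t) t := by
    intro t ht
    refine HasDerivAt.fun_sum fun j hj => ?_
    exact (cx_min_sq (x j t)).comp t (hd j hj t ht)
  set K := ∑ j ∈ s, 2 * C j with hK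
  have hVle : ∀ t ∈ Set.Icc 0 T, ∑ j ∈ s, 2 * min (x j t) 0 * d j t ≤ K * V t := by
    intro t ht
    rw [hK, Finset.sum_mul]
    refine Finset.sum_le_sum fun j hj => ?_
    have := hC j hj t ht
    simp only [hV]
    linarith
  have hexp : ∀ t, HasDerivAt (fun t => Real.exp (-K * t)) (Real.exp (-K * t) * (-K)) t := by
    intro t
    have := ((hasDerivAt_id t).const_mul (-K)).exp
    simpa using this
  have hanti : AntitoneOn (fun t => V t * Real.exp (-K * t)) (Set.Icc 0 T) := by
    refine cx_antitone T _ _ _ (convex_Icc 0 T) (fun t ht => (hVd t ht.1).mul (hexp t)) ?_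
    intro t ht
    have h1 := hVle t ht
    have h2 := Real.exp_pos (-K * t)
    nlinarith
  intro i hi t ht
  have hz : V 0 = 0 := by
    simp only [hV]
    refine Finset.sum_eq_zero fun j hj => ?_
    rw [min_eq_right (h0 j hj)]; simp
  have h1 := hanti (Set.left_mem_Icc.2 (ht.1.trans ht.2)) ht ht.1
  simp only [hz, zero_mul] at h1
  have h2 : V t ≤ 0 := by
    by_contra hc
    push Not at hc
    have := mul_pos hc (Real.exp_pos (-K * t))
    linarith
  have h3 : (min (x i t) 0)^2 ≤ V t :=
    Finset.single_le_sum (f := fun j => (min (x j t) 0)^2) (fun j _ => sq_nonneg _) hi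
  have h4 : min (x i t) 0 = 0 := by
    have : (min (x i t) 0)^2 = 0 := le_antisymm (h3.trans h2) (sq_nonneg _)
    simpa using this
  rw [← h4]; exact min_le_left _ _

lemma cx_exp (a t : ℝ) :
    HasDerivAt (fun t => Real.exp (a * t)) (Real.exp (a * t) * a) t := by
  have := ((hasDerivAt_id t).const_mul a).exp
  simpa using this

lemma cx_lin_half (x u : ℝ → ℝ) (a : ℝ) (ha : 0 < a)
    (hx : ∀ t, 0 ≤ t → HasDerivAt x (u t - a * x t) t) (hu : Tendsto u atTop (𝓝 0))
    (ε : ℝ) (hε : 0 < ε) : ∀ᶠ t in atTop, x t < ε := by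
  have h1 : ∀ᶠ t in atTop, u t < a * (ε / 2) := hu.eventually (gt_mem_nhds (by positivity))
  obtain ⟨T, hT⟩ := eventually_atTop.1 (h1.and (eventually_ge_atTop 0))
  have hT0 : 0 ≤ T := (hT T le_rfl).2
  have hanti : AntitoneOn (fun t => (x t - ε / 2) * Real.exp (a * t)) (Set.Ici T) := by
    refine cx_antitone T _ _ _ (convex_Ici T)
      (fun t ht => ((hx t (hT0.trans ht)).sub_const (ε / 2)).mul (cx_exp a t)) ?_
    intro t ht
    have h2 := Real.exp_pos (a * t)
    have h3 := (hT t ht).1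
    nlinarith
  set M := (x T - ε / 2) * Real.exp (a * T) with hM
  have hlim : Tendsto (fun t => M * Real.exp (-(a * t))) atTop (𝓝 0) := by
    have : Tendsto (fun t => Real.exp (-(a * t))) atTop (𝓝 0) :=
      Real.tendsto_exp_neg_atTop_nhds_zero.comp (tendsto_id.const_mul_atTop ha)
    simpa using this.const_mul M
  filter_upwards [hlim.eventually (gt_mem_nhds (half_pos hε)), eventually_ge_atTop T] with t h1 h2
  have h3 := hanti (Set.self_mem_Ici) h2 h2
  simp only at h3
  rw [← hM] at h3
  have h4 := mul_le_mul_of_nonneg_right h3 (Real.exp_pos (-(a*t))).le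
  rw [mul_assoc, ← Real.exp_add] at h4
  simp at h4
  linarith

lemma cx_lin (x u : ℝ → ℝ) (a : ℝ) (ha : 0 < a)
    (hx : ∀ t, 0 ≤ t → HasDerivAt x (u t - a * x t) t) (hu : Tendsto u atTop (𝓝 0)) :
    Tendsto x atTop (𝓝 0) := by
  rw [Metric.tendsto_nhds]
  intro ε hε
  have h2 : ∀ᶠ t in atTop, -x t < ε := by
    refine cx_lin_half (fun t => -x t) (fun t => -u t) a ha ?_ (by simpa using hu.neg) ε hε
    intro t ht
    have h := (hx t ht).fun_neg
    rwa [show -(u t - a * x t) = -u t - a * -x t by ring] at h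
  filter_upwards [cx_lin_half x u a ha hx hu ε hε, h2] with t h1 h2
  rw [Real.dist_eq, sub_zero, abs_lt]
  constructor <;> linarith

lemma cx_barbalat (g g' g'' : ℝ → ℝ) (l K : ℝ) (hg : Tendsto g atTop (𝓝 l))
    (h1 : ∀ t, 0 ≤ t → HasDerivAt g (g' t) t) (h2 : ∀ t, 0 ≤ t → HasDerivAt g' (g'' t) t)
    (hK : ∀ t, 0 ≤ t → |g'' t| ≤ K) : Tendsto g' atTop (𝓝 0) := by
  rw [Metric.tendsto_nhds]
  intro ε hε
  have hK0 : 0 ≤ K := (abs_nonneg _).trans (hK 0 le_rfl)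
  set δ := ε / (2 * (K + 1)) with hδ
  have hδ0 : 0 < δ := by positivity
  have hKδ : K * δ < ε / 2 := by
    have : (K + 1) * δ = ε / 2 := by rw [hδ]; field_simp
    nlinarith
  have hlim : Tendsto (fun t => g (t + δ) - g t) atTop (𝓝 0) := by
    have := (hg.comp (tendsto_atTop_add_const_right _ δ tendsto_id)).sub hg
    simpa using this
  have hpos : 0 < δ * (ε / 2) := by positivity
  filter_upwards [(Metric.tendsto_nhds.1 hlim) _ hpos, eventually_ge_atTop 0] with t ht ht0
  rw [Real.dist_eq, sub_zero] at ht ⊢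
  obtain ⟨c, hc, hceq⟩ := exists_hasDerivAt_eq_slope g g' (show t < t + δ by linarith)
    (fun y hy => (h1 y (ht0.trans hy.1)).continuousAt.continuousWithinAt)
    (fun y hy => h1 y (ht0.trans hy.1.le))
  have hb : ‖g' c - g' t‖ ≤ K * ‖c - t‖ :=
    (convex_Ici (0:ℝ)).norm_image_sub_le_of_norm_hasDerivWithin_le (f := g') (f' := g'')
      (fun y hy => (h2 y hy).hasDerivWithinAt) (fun y hy => hK y hy) ht0 (ht0.trans hc.1.le)
  rw [Real.norm_eq_abs, Real.norm_eq_abs, abs_of_pos (sub_pos.2 hc.1)] at hb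
  have hb2 : K * (c - t) ≤ K * δ := mul_le_mul_of_nonneg_left (by linarith [hc.2]) hK0
  have hgc : |g' c| < ε / 2 := by
    rw [hceq, add_sub_cancel_left, abs_div, abs_of_pos hδ0, div_lt_iff₀ hδ0]
    linarith
  have := abs_sub_abs_le_abs_sub (g' t) (g' c)
  rw [abs_sub_comm] at this
  linarith

/-- Weights of the Lyapunov function. -/
noncomputable def cxW (lam p : ℕ → ℝ) (μ : ℝ) : ℕ → ℝ
  | 0 => 0
  | (k+1) => lam (k+1) / (lam (k+1) + μ) * (p k + (1 - p k) * cxW lam p μ k)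

lemma cx_R0 (lam p : ℕ → ℝ) (μ : ℝ) (n : ℕ) : ∑ i ∈ Finset.range n,
      (p i * ∏ j ∈ Finset.Icc 1 (n - 1 - i), (1 - p (j + i))) *
        ∏ k ∈ Finset.Icc 1 (n - i), lam (n + 1 - k) / (lam (n + 1 - k) + μ) = cxW lam p μ n := by
  induction n with
  | zero => simp [cxW]
  | succ n ih =>
    rw [Finset.sum_range_succ, cxW, ← ih, mul_add, add_comm, Finset.mul_sum, Finset.mul_sum]
    congr 1
    · simp; ring
    · refine Finset.sum_congr rfl fun i hi => ?_
      rw [Finset.mem_range] at hi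
      obtain ⟨k, rfl⟩ : ∃ k, n = i + 1 + k := ⟨n - i - 1, by omega⟩
      have e1 : i + 1 + k + 1 - 1 - i = k + 1 := by omega
      have e2 : i + 1 + k + 1 - i = (k + 1) + 1 := by omega
      have e3 : i + 1 + k - 1 - i = k := by omega
      have e4 : i + 1 + k - i = k + 1 := by omega
      rw [e1, e2, e3, e4, Finset.prod_Icc_succ_top (by omega : 1 ≤ k + 1)]
      have e5 : ∏ j ∈ Finset.Icc 1 (k + 1 + 1), lam (i + 1 + k + 1 + 1 - j) /
          (lam (i + 1 + k + 1 + 1 - j) + μ) = lam (i + 1 + k + 1) / (lam (i + 1 + k + 1) + μ) *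
          ∏ j ∈ Finset.Icc 1 (k + 1), lam (i + 1 + k + 1 - j) / (lam (i + 1 + k + 1 - j) + μ) := by
        rw [← Finset.prod_Ioc_mul_eq_prod_Icc (by omega : 1 ≤ k + 1 + 1), mul_comm]
        congr 1
        refine (Finset.prod_bij (fun a _ => a + 1) ?_ ?_ ?_ ?_).symm
        · intro a ha; simp at ha ⊢; omega
        · intro a _ b _ h; omega
        · intro b hb; simp at hb; exact ⟨b - 1, by simp; omega, by omega⟩
        · intro a ha
          have : i + 1 + k + 1 + 1 - (a + 1) = i + 1 + k + 1 - a := by omega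
          rw [this]
      rw [e5, show k + 1 + i = i + 1 + k by omega]
      ring

lemma cx_chain (c r lam p e : ℕ → ℝ) (k : ℕ) (h1 : c 1 * r 1 = lam 1 * p 0)
    (h : ∀ j < k, c (j+2) * r (j+2) = lam (j+2) * (c (j+1) * (1 - p (j+1)) + p (j+1))) :
    ∑ i ∈ Finset.range k, c (i+1) * ((1 - p (i+1)) * lam (i+1+1) * e (i+1+1) - r (i+1) * e (i+1))
      + ∑ i ∈ Finset.range (k+1), p i * lam (i+1) * e (i+1) = c (k+1) * (r (k+1) * e (k+1)) := by
  induction k with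
  | zero => simp; linear_combination (-e 1) * h1
  | succ k ih =>
    rw [Finset.sum_range_succ, Finset.sum_range_succ _ (k+1)]
    have := ih (fun j hj => h j (by omega))
    linear_combination this - e (k+2) * h k (by omega)

/-- Global asymptotic stability of the disease-free equilibrium of the Coxian
distributed SEIR model with constant contact rate, when `R0 ≤ 1`. -/
theorem coxian_seir_dfe_global_stability
    (n : ℕ) (hn : 1 ≤ n) (μ γ β : ℝ) (hμ : 0 < μ) (hγ : 0 < γ) (hβ : 0 < β)
    (lam p : ℕ → ℝ) (hlam : ∀ i, 1 ≤ i → i ≤ n → 0 < lam i)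
    (hp0 : p 0 = 1) (hp : ∀ i, 1 ≤ i → i ≤ n - 1 → 0 < p i ∧ p i < 1)
    (R0 : ℝ)
    (hR0 : R0 = β / (γ + μ) * ∑ i ∈ Finset.range n,
      (p i * ∏ j ∈ Finset.Icc 1 (n - 1 - i), (1 - p (j + i))) *
        ∏ k ∈ Finset.Icc 1 (n - i), lam (n + 1 - k) / (lam (n + 1 - k) + μ))
    (S I R : ℝ → ℝ) (E : ℕ → ℝ → ℝ)
    (hS : ∀ t, 0 ≤ t → HasDerivAt S (μ - β * S t * I t - μ * S t) t)
    (hEn : ∀ t, 0 ≤ t → HasDerivAt (E n) (β * S t * I t - (lam n + μ) * E n t) t)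
    (hEi : ∀ i, 1 ≤ i → i ≤ n - 1 → ∀ t, 0 ≤ t →
      HasDerivAt (E i) ((1 - p i) * lam (i + 1) * E (i + 1) t - (lam i + μ) * E i t) t)
    (hI : ∀ t, 0 ≤ t → HasDerivAt I
      ((∑ i ∈ Finset.range n, p i * lam (i + 1) * E (i + 1) t) - (γ + μ) * I t) t)
    (hR : ∀ t, 0 ≤ t → HasDerivAt R (γ * I t - μ * R t) t)
    (hR0le : R0 ≤ 1)
    (hS0 : 0 ≤ S 0) (hE0 : ∀ i, 1 ≤ i → i ≤ n → 0 ≤ E i 0)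
    (hI0 : 0 ≤ I 0) (hRinit : 0 ≤ R 0)
    (hsum : S 0 + (∑ j ∈ Finset.Icc 1 n, E j 0) + I 0 + R 0 = 1) :
    Tendsto S atTop (𝓝 1) ∧
    (∀ i, 1 ≤ i → i ≤ n → Tendsto (E i) atTop (𝓝 0)) ∧
    Tendsto I atTop (𝓝 0) ∧ Tendsto R atTop (𝓝 0) := by
  obtain ⟨m, rfl⟩ : ∃ m, n = m + 1 := ⟨n - 1, by omega⟩
  rw [cx_R0] at hR0
  simp only [add_tsub_cancel_right] at hp hEi
  have hsum' : ∀ f : ℕ → ℝ, ∑ j ∈ Finset.Icc 1 (m + 1), f j = ∑ i ∈ Finset.range (m + 1), f (i + 1) := by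
    intro f
    rw [Finset.range_eq_Ico, Finset.sum_Ico_add' f 0 (m+1) 1]
    rfl
  rw [hsum'] at hsum
  have hScont : ContinuousOn S (Set.Ici 0) := fun t ht => (hS t ht).continuousAt.continuousWithinAt
  have hIcont : ContinuousOn I (Set.Ici 0) := fun t ht => (hI t ht).continuousAt.continuousWithinAt
  have hbd : ∀ f : ℝ → ℝ, ContinuousOn f (Set.Ici 0) → ∀ T : ℝ, ∃ B, 0 ≤ B ∧ ∀ t ∈ Set.Icc 0 T, |f t| ≤ B := by
    intro f hf T
    obtain ⟨B, hB⟩ := isCompact_Icc.exists_bound_of_continuousOn (hf.mono (Set.Icc_subset_Ici_self (b := (0:ℝ)) (a := T)))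
    exact ⟨max B 0, le_max_right _ _, fun t ht => (hB t ht).trans (le_max_left _ _)⟩
  -- nonnegativity of S
  have hSnn : ∀ t, 0 ≤ t → 0 ≤ S t := by
    intro T hT
    obtain ⟨B, hB0, hB⟩ := hbd I hIcont T
    refine cx_nonneg {()} (fun _ => S) T (by simpa using hS0) ?_ () (by simp) T ⟨hT, le_rfl⟩
    intro i _
    refine ⟨_, β * B, hS, ?_⟩
    intro t ht
    rw [Finset.sum_singleton]
    have hIt := (abs_le.1 (hB t ht)).1
    rcases le_total (S t) 0 with h | h
    · rw [min_eq_left h]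
      have h1 : 0 ≤ β * (S t)^2 * (B + I t) := by
        have : 0 ≤ B + I t := by linarith
        positivity
      nlinarith [mul_nonneg hμ.le (sq_nonneg (S t))]
    · rw [min_eq_right h]; simp
  obtain ⟨x, hxI, hxE⟩ : ∃ x : ℕ → ℝ → ℝ, x 0 = I ∧ ∀ i, x (i+1) = E (i+1) :=
    ⟨fun i => if i = 0 then I else E i, by simp, by intro i; simp⟩
  have hIE : ∀ T, 0 ≤ T → ∀ i ∈ Finset.range (m+1+1), 0 ≤ x i T := by
    intro T hT i hi
    obtain ⟨B, hB0, hB⟩ := hbd S hScont T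
    refine cx_nonneg (Finset.range (m+1+1)) x T ?_ ?_ i hi T ⟨hT, le_rfl⟩
    · intro i hi
      rw [Finset.mem_range] at hi
      rcases i with _ | i
      · rw [hxI]; exact hI0
      · rw [hxE]; exact hE0 (i+1) (by omega) (by omega)
    · clear hi i
      intro i hi
      have hoff : ∀ t, ∀ i ∈ Finset.range (m+1+1), ∀ j ∈ Finset.range (m+1+1), ∀ a : ℝ, 0 ≤ a →
          min (x i t) 0 * (a * x j t) ≤ a * ∑ j ∈ Finset.range (m+1+1), (min (x j t) 0)^2 := by
        intro t i hi j hj a ha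
        have h1 := Finset.single_le_sum (f := fun j => (min (x j t) 0)^2) (fun j _ => sq_nonneg _) hi
        have h2 := Finset.single_le_sum (f := fun j => (min (x j t) 0)^2) (fun j _ => sq_nonneg _) hj
        have h3 : min (x i t) 0 * x j t ≤ min (x i t) 0 * min (x j t) 0 :=
          mul_le_mul_of_nonpos_left (min_le_left _ _) (min_le_right _ _)
        have h4 : min (x i t) 0 * x j t ≤ ∑ j ∈ Finset.range (m+1+1), (min (x j t) 0)^2 := by
          nlinarith [sq_nonneg (min (x i t) 0 - min (x j t) 0)]
        calc _ = a * (min (x i t) 0 * x j t) := by ring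
          _ ≤ _ := mul_le_mul_of_nonneg_left h4 ha
      have hdiag : ∀ t i, ∀ a : ℝ, 0 ≤ a → 0 ≤ min (x i t) 0 * (a * x i t) := by
        intro t i a ha
        rcases le_total (x i t) 0 with h | h
        · rw [min_eq_left h]; nlinarith [mul_nonneg ha (sq_nonneg (x i t))]
        · rw [min_eq_right h]; simp
      rw [Finset.mem_range] at hi
      rcases i with _ | i
      · refine ⟨_, ∑ i ∈ Finset.range (m+1), p i * lam (i+1), by rw [hxI]; exact hI, ?_⟩
        intro t ht
        have h1 := hdiag t 0 (γ + μ) (by positivity)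
        rw [hxI] at h1 ⊢
        rw [mul_sub, Finset.mul_sum, Finset.sum_mul]
        refine (sub_le_self _ h1).trans (Finset.sum_le_sum fun j hj => ?_)
        rw [Finset.mem_range] at hj
        have hpj : 0 ≤ p j := by
          rcases j with _ | j
          · rw [hp0]; norm_num
          · exact (hp (j+1) (by omega) (by omega)).1.le
        have h2 := hoff t 0 (by simp) (j+1) (by simp; omega) (p j * lam (j+1))
          (mul_nonneg hpj (hlam (j+1) (by omega) (by omega)).le)
        rwa [hxI, hxE] at h2
      · have hl := hlam (i+1) (by omega) (by omega)
        by_cases him : i = m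
        · subst him
          refine ⟨_, β * B, by rw [hxE]; exact hEn, ?_⟩
          intro t ht
          have h1 := hdiag t (i+1) (lam (i+1) + μ) (by positivity)
          have h2 := hoff t (i+1) (by simp) 0 (by simp) (β * S t) (mul_nonneg hβ.le (hSnn t ht.1))
          rw [hxE] at h1 h2 ⊢
          rw [hxI] at h2
          rw [mul_sub]
          refine (sub_le_self _ h1).trans (h2.trans ?_)
          refine mul_le_mul_of_nonneg_right ?_ (Finset.sum_nonneg fun j _ => sq_nonneg _)
          exact mul_le_mul_of_nonneg_left ((le_abs_self _).trans (hB t ht)) hβ.le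
        · have hpi := hp (i+1) (by omega) (by omega)
          have hl2 := hlam (i+1+1) (by omega) (by omega)
          refine ⟨_, (1 - p (i+1)) * lam (i+1+1), by rw [hxE]; exact hEi (i+1) (by omega) (by omega), ?_⟩
          intro t ht
          have h1 := hdiag t (i+1) (lam (i+1) + μ) (by positivity)
          have h2 := hoff t (i+1) (by simp; omega) (i+1+1) (by simp; omega) ((1 - p (i+1)) * lam (i+1+1))
            (mul_nonneg (by linarith) hl2.le)
          rw [hxE] at h1 h2 ⊢
          rw [hxE] at h2
          rw [mul_sub]
          exact (sub_le_self _ h1).trans h2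
  have hInn : ∀ t, 0 ≤ t → 0 ≤ I t := by
    intro t ht
    simpa [hxI] using hIE t ht 0 (by simp)
  have hEnn : ∀ i < m + 1, ∀ t, 0 ≤ t → 0 ≤ E (i+1) t := by
    intro i hi t ht
    simpa [hxE] using hIE t ht (i+1) (by simp; omega)
  clear hIE
  have hRnn : ∀ t, 0 ≤ t → 0 ≤ R t := by
    intro T hT
    refine cx_nonneg {()} (fun _ => R) T (by simpa using hRinit) ?_ () (by simp) T ⟨hT, le_rfl⟩
    intro i _
    refine ⟨_, 0, hR, ?_⟩
    intro t ht
    have hIt := hInn t ht.1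
    rcases le_total (R t) 0 with h | h
    · rw [min_eq_left h]
      nlinarith [mul_nonneg hμ.le (sq_nonneg (R t)), mul_nonneg hγ.le hIt]
    · rw [min_eq_right h]; simp
  -- weighted sums of E
  have hEsum : ∀ c : ℕ → ℝ, ∀ t, 0 ≤ t →
      HasDerivAt (fun t => ∑ i ∈ Finset.range (m+1), c (i+1) * E (i+1) t)
        (∑ i ∈ Finset.range m, c (i+1) * ((1 - p (i+1)) * lam (i+1+1) * E (i+1+1) t
          - (lam (i+1) + μ) * E (i+1) t) + c (m+1) * (β * S t * I t - (lam (m+1) + μ) * E (m+1) t)) t := by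
    intro c t ht
    simp only [Finset.sum_range_succ _ m]
    refine HasDerivAt.fun_add (HasDerivAt.fun_sum fun i hi => ?_) ((hEn t ht).const_mul _)
    rw [Finset.mem_range] at hi
    exact (hEi (i+1) (by omega) (by omega) t ht).const_mul _
  -- total mass
  have hN : ∀ t, 0 ≤ t → S t + (∑ i ∈ Finset.range (m+1), E (i+1) t) + I t + R t = 1 := by
    set N : ℝ → ℝ := fun t => S t + (∑ i ∈ Finset.range (m+1), E (i+1) t) + I t + R t with hNdef
    have hNd : ∀ t, 0 ≤ t → HasDerivAt N (-μ * (N t - 1)) t := by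
      intro t ht
      have h1 := hEsum (fun _ => 1) t ht
      simp only [one_mul] at h1
      have h2 := (((hS t ht).fun_add h1).fun_add (hI t ht)).fun_add (hR t ht)
      have h3 := cx_chain (fun _ => 1) lam lam p (fun i => E i t) m (by simp [hp0]) (by intro j _; ring)
      simp only [one_mul] at h3
      have h4 : ∑ i ∈ Finset.range m, ((1 - p (i+1)) * lam (i+1+1) * E (i+1+1) t
          - (lam (i+1) + μ) * E (i+1) t) = ∑ i ∈ Finset.range m, ((1 - p (i+1)) * lam (i+1+1) * E (i+1+1) t
          - lam (i+1) * E (i+1) t) - μ * ∑ i ∈ Finset.range m, E (i+1) t := by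
        rw [Finset.mul_sum, ← Finset.sum_sub_distrib]
        exact Finset.sum_congr rfl fun i _ => by ring
      have h5 : N t = S t + ((∑ i ∈ Finset.range m, E (i+1) t) + E (m+1) t) + I t + R t := by
        simp only [hNdef, Finset.sum_range_succ _ m]
      refine h2.congr_deriv ?_
      rw [h5]
      linear_combination h4 + h3
    have hG : ∀ t, 0 ≤ t → HasDerivAt (fun t => (N t - 1) * Real.exp (μ * t)) 0 t := by
      intro t ht
      refine (((hNd t ht).sub_const 1).mul (cx_exp μ t)).congr_deriv ?_
      ring
    have hN0 : N 0 = 1 := hsum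
    intro t ht
    have hc := (convex_Ici (0:ℝ)).norm_image_sub_le_of_norm_hasDerivWithin_le (C := 0)
      (f := fun t => (N t - 1) * Real.exp (μ * t)) (f' := fun _ => 0)
      (fun y hy => (hG y hy).hasDerivWithinAt) (fun y hy => by simp) (Set.self_mem_Ici) ht
    simp only [hN0, sub_self, zero_mul, sub_zero, norm_le_zero_iff] at hc
    have := (mul_eq_zero.1 hc).resolve_right (Real.exp_pos _).ne'
    change N t = 1
    linarith
  have hEsnn : ∀ t, 0 ≤ t → 0 ≤ ∑ i ∈ Finset.range (m+1), E (i+1) t := fun t ht =>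
    Finset.sum_nonneg fun i hi => hEnn i (Finset.mem_range.1 hi) t ht
  have hS1 : ∀ t, 0 ≤ t → S t ≤ 1 := fun t ht => by
    linarith [hN t ht, hEsnn t ht, hInn t ht, hRnn t ht]
  have hI1 : ∀ t, 0 ≤ t → I t ≤ 1 := fun t ht => by
    linarith [hN t ht, hEsnn t ht, hSnn t ht, hRnn t ht]
  have hE1 : ∀ i < m + 1, ∀ t, 0 ≤ t → E (i+1) t ≤ 1 := fun i hi t ht => by
    have := Finset.single_le_sum (f := fun i => E (i+1) t)
      (fun j hj => hEnn j (Finset.mem_range.1 hj) t ht) (Finset.mem_range.2 hi)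
    linarith [hN t ht, hSnn t ht, hRnn t ht, hInn t ht]
  -- derivative bounds
  set dS : ℝ → ℝ := fun t => μ - β * S t * I t - μ * S t with hdS
  set dI : ℝ → ℝ := fun t => (∑ i ∈ Finset.range (m+1), p i * lam (i + 1) * E (i + 1) t) - (γ + μ) * I t with hdI
  have hSa : ∀ t, 0 ≤ t → |S t| ≤ 1 := fun t ht => abs_le.2 ⟨by linarith [hSnn t ht], hS1 t ht⟩
  have hIa : ∀ t, 0 ≤ t → |I t| ≤ 1 := fun t ht => abs_le.2 ⟨by linarith [hInn t ht], hI1 t ht⟩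
  have hEa : ∀ i < m + 1, ∀ t, 0 ≤ t → |E (i+1) t| ≤ 1 := fun i hi t ht =>
    abs_le.2 ⟨by linarith [hEnn i hi t ht], hE1 i hi t ht⟩
  have hmulb : ∀ a b A B : ℝ, |a| ≤ A → |b| ≤ B → |a * b| ≤ A * B := by
    intro a b A B ha hb
    rw [abs_mul]
    exact mul_le_mul ha hb (abs_nonneg _) ((abs_nonneg _).trans ha)
  obtain ⟨BS, hBS⟩ : ∃ B, ∀ t, 0 ≤ t → |dS t| ≤ B := by
    refine ⟨μ + β * 1 * 1 + μ * 1, fun t ht => ?_⟩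
    have h1 := hmulb _ _ _ _ (hmulb β (S t) β 1 (abs_of_pos hβ).le (hSa t ht)) (hIa t ht)
    have h2 := hmulb μ (S t) μ 1 (abs_of_pos hμ).le (hSa t ht)
    simp only [hdS]
    refine (abs_sub _ _).trans (add_le_add ((abs_sub _ _).trans (add_le_add (abs_of_pos hμ).le h1)) h2)
  obtain ⟨BI, hBI⟩ : ∃ B, ∀ t, 0 ≤ t → |dI t| ≤ B := by
    refine ⟨(∑ i ∈ Finset.range (m+1), |p i * lam (i + 1)| * 1) + |γ + μ| * 1, fun t ht => ?_⟩
    simp only [hdI]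
    refine (abs_sub _ _).trans (add_le_add ?_ (hmulb _ _ _ _ le_rfl (hIa t ht)))
    refine (Finset.abs_sum_le_sum_abs _ _).trans (Finset.sum_le_sum fun i hi => ?_)
    exact hmulb _ _ _ _ le_rfl (hEa i (Finset.mem_range.1 hi) t ht)
  -- Lyapunov function
  set c := cxW lam p μ with hc
  have hc0 : ∀ k ≤ m + 1, 0 ≤ c k := by
    intro k
    induction k with
    | zero => intro _; simp [hc, cxW]
    | succ k ih =>
      intro hk
      have h1 := ih (by omega)
      have hl := hlam (k+1) (by omega) hk
      rw [hc, cxW, ← hc]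
      rcases k with _ | k
      · simp only [hp0]
        simp only [sub_self, zero_mul, add_zero, mul_one]
        positivity
      · have hpk := hp (k+1) (by omega) (by omega)
        have : 0 ≤ 1 - p (k+1) := by linarith
        have := hpk.1
        positivity
  set L : ℝ → ℝ := fun t => (∑ i ∈ Finset.range (m+1), c (i+1) * E (i+1) t) + I t with hL
  have hgm : 0 < γ + μ := by positivity
  have hLd : ∀ t, 0 ≤ t → HasDerivAt L ((γ + μ) * ((R0 * S t - 1) * I t)) t := by
    intro t ht
    have h2 := (hEsum c t ht).fun_add (hI t ht)
    have hcr : ∀ k < m + 1, c (k+1) * (lam (k+1) + μ) = lam (k+1) * (p k + (1 - p k) * c k) := by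
      intro k hk
      have hl := hlam (k+1) (by omega) hk
      rw [hc, cxW, ← hc]
      field_simp
    have h3 := cx_chain c (fun i => lam i + μ) lam p (fun i => E i t) m
      (by have := hcr 0 (by omega); simpa [hp0] using this)
      (by intro j hj; have := hcr (j+1) (by omega); linear_combination this)
    have h4 : (γ + μ) * R0 = β * c (m+1) := by
      rw [hR0]; field_simp
    refine h2.congr_deriv ?_
    linear_combination h3 - (S t * I t) * h4
  have hLd' : ∀ t, 0 ≤ t → (γ + μ) * ((1 - S t) * I t) ≤ -((γ + μ) * ((R0 * S t - 1) * I t)) := by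
    intro t ht
    have h1 : 0 ≤ (1 - R0) * (S t * I t) :=
      mul_nonneg (by linarith) (mul_nonneg (hSnn t ht) (hInn t ht))
    have h2 := mul_nonneg hgm.le h1
    linarith
  have hWI0 : ∀ t, 0 ≤ t → 0 ≤ (γ + μ) * ((1 - S t) * I t) := fun t ht =>
    mul_nonneg hgm.le (mul_nonneg (by linarith [hS1 t ht]) (hInn t ht))
  have hLanti : AntitoneOn L (Set.Ici 0) :=
    cx_antitone 0 _ _ _ (convex_Ici 0) (fun t ht => hLd t ht)
      (fun t ht => by linarith [hLd' t ht, hWI0 t ht])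
  have hLnn : ∀ t, 0 ≤ t → 0 ≤ L t := fun t ht =>
    add_nonneg (Finset.sum_nonneg fun i hi => mul_nonneg (hc0 _ (by
      have := Finset.mem_range.1 hi; omega)) (hEnn i (Finset.mem_range.1 hi) t ht)) (hInn t ht)
  obtain ⟨l, hl⟩ : ∃ l, Tendsto L atTop (𝓝 l) := by
    have h1 : Antitone (fun t => L (max t 0)) := fun a b hab =>
      hLanti (Set.mem_Ici.2 (le_max_right _ _)) (Set.mem_Ici.2 (le_max_right _ _)) (max_le_max_right 0 hab)
    have h2 := tendsto_atTop_ciInf h1 ⟨0, by rintro _ ⟨t, rfl⟩; exact hLnn _ (le_max_right _ _)⟩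
    refine ⟨_, h2.congr' ?_⟩
    filter_upwards [eventually_ge_atTop 0] with t ht
    rw [max_eq_left ht]
  have hLd0 : Tendsto (fun t => (γ + μ) * ((R0 * S t - 1) * I t)) atTop (𝓝 0) := by
    refine cx_barbalat L _ (fun t => (γ + μ) * ((R0 * dS t) * I t + (R0 * S t - 1) * dI t)) l
      ((γ + μ) * ((|R0| * BS) * 1 + (|R0| * 1 + 1) * BI)) hl hLd ?_ ?_
    · intro t ht
      exact ((((hS t ht).const_mul R0).sub_const 1).mul (hI t ht)).const_mul _
    · intro t ht
      refine hmulb _ _ _ _ (abs_of_pos hgm).le ((abs_add_le _ _).trans (add_le_add ?_ ?_))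
      · exact hmulb _ _ _ _ (hmulb _ _ _ _ le_rfl (hBS t ht)) (hIa t ht)
      · refine hmulb _ _ _ _ ((abs_sub _ _).trans (add_le_add (hmulb _ _ _ _ le_rfl (hSa t ht)) ?_)) (hBI t ht)
        simp
  have hWI : Tendsto (fun t => (1 - S t) * I t) atTop (𝓝 0) := by
    have h1 : Tendsto (fun t => (γ + μ) * ((1 - S t) * I t)) atTop (𝓝 0) := by
      refine tendsto_of_tendsto_of_tendsto_of_le_of_le' tendsto_const_nhds
        (by simpa using hLd0.neg) ?_ ?_
      · filter_upwards [eventually_ge_atTop 0] with t ht using hWI0 t ht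
      · filter_upwards [eventually_ge_atTop 0] with t ht using hLd' t ht
    have h2 := h1.const_mul (γ + μ)⁻¹
    simpa [inv_mul_cancel_left₀ hgm.ne'] using h2
  have hWSI : Tendsto (fun t => 2 * β * ((1 - S t) * I t * S t)) atTop (𝓝 0) := by
    have h1 : Tendsto (fun t => (1 - S t) * I t * S t) atTop (𝓝 0) := by
      refine tendsto_of_tendsto_of_tendsto_of_le_of_le' tendsto_const_nhds hWI ?_ ?_
      · filter_upwards [eventually_ge_atTop 0] with t ht
        exact mul_nonneg (mul_nonneg (by linarith [hS1 t ht]) (hInn t ht)) (hSnn t ht)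
      · filter_upwards [eventually_ge_atTop 0] with t ht
        exact mul_le_of_le_one_right (mul_nonneg (by linarith [hS1 t ht]) (hInn t ht)) (hS1 t ht)
    simpa using h1.const_mul (2 * β)
  have hW2 : Tendsto (fun t => (1 - S t)^2) atTop (𝓝 0) := by
    refine cx_lin _ _ (2 * μ) (by positivity) ?_ hWSI
    intro t ht
    refine (((hS t ht).const_sub 1).fun_pow 2).congr_deriv ?_
    ring
  have hW : Tendsto (fun t => 1 - S t) atTop (𝓝 0) := by
    have h1 := (Real.continuous_sqrt.tendsto 0).comp hW2
    rw [Real.sqrt_zero] at h1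
    refine h1.congr' ?_
    filter_upwards [eventually_ge_atTop 0] with t ht
    exact Real.sqrt_sq (by linarith [hS1 t ht])
  have hSlim : Tendsto S atTop (𝓝 1) := by
    have := hW.const_sub 1
    simpa using this
  have hdS0 : Tendsto dS atTop (𝓝 0) := by
    refine cx_barbalat S dS (fun t => 0 - (β * dS t * I t + β * S t * dI t) - μ * dS t) 1
      (0 + (β * BS * 1 + β * 1 * BI) + μ * BS) hSlim hS ?_ ?_
    · intro t ht
      exact ((hasDerivAt_const t μ).sub (((hS t ht).const_mul β).mul (hI t ht))).sub ((hS t ht).const_mul μ)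
    · intro t ht
      have hβ' := (abs_of_pos hβ).le
      refine (abs_sub _ _).trans (add_le_add ((abs_sub _ _).trans (add_le_add (by simp)
        ((abs_add_le _ _).trans (add_le_add ?_ ?_)))) (hmulb _ _ _ _ (abs_of_pos hμ).le (hBS t ht)))
      · exact hmulb _ _ _ _ (hmulb _ _ _ _ hβ' (hBS t ht)) (hIa t ht)
      · exact hmulb _ _ _ _ (hmulb _ _ _ _ hβ' (hSa t ht)) (hBI t ht)
  have hSI : Tendsto (fun t => β * S t * I t) atTop (𝓝 0) := by
    have h1 := (hW.const_mul μ).sub hdS0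
    simp only [mul_zero, sub_zero] at h1
    refine h1.congr fun t => ?_
    simp only [hdS]; ring
  have hIlim : Tendsto I atTop (𝓝 0) := by
    have h1 := hWI.add (hSI.const_mul β⁻¹)
    simp only [mul_zero, add_zero] at h1
    refine h1.congr fun t => ?_
    field_simp
    ring
  have hElim : ∀ k ≤ m, Tendsto (E (m + 1 - k)) atTop (𝓝 0) := by
    intro k
    induction k with
    | zero =>
      intro _
      have := hlam (m+1) (by omega) le_rfl
      exact cx_lin _ _ (lam (m+1) + μ) (by positivity) hEn hSI
    | succ k ih =>
      intro hk
      have h1 := ih (by omega)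
      obtain ⟨i, hi⟩ : ∃ i, m + 1 - (k+1) = i := ⟨_, rfl⟩
      rw [show m + 1 - k = i + 1 by omega] at h1
      rw [hi]
      have := hlam i (by omega) (by omega)
      refine cx_lin _ _ (lam i + μ) (by positivity) (hEi i (by omega) (by omega)) ?_
      simpa using h1.const_mul ((1 - p i) * lam (i+1))
  refine ⟨hSlim, ?_, hIlim, ?_⟩
  · intro i h1 h2
    have := hElim (m + 1 - i) (by omega)
    rwa [show m + 1 - (m + 1 - i) = i by omega] at this
  · exact cx_lin R _ μ hμ hR (by simpa using hIlim.const_mul γ)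
end

section
/- Consider the Coxian distributed SEIR model with constant contact rate: differentiable functions S, E_n, ..., E_1, I, R : [0,∞) → ℝ satisfying S' = μ − β̄·S·I − μ·S, E_n' = β̄·S·I − (λ_n+μ)·E_n, E_i' = p̄_i·λ_{i+1}·E_{i+1} − (λ_i+μ)·E_i for i = n−1,...,1, I' = Σ_{i=0}^{n−1} p_i·λ_{i+1}·E_{i+1} − (γ+μ)·I, and R' = γ·I − μ·R. Suppose R_0 > 1 and the initial data are strictly positive with S(0) + Σ_{j=1}^n E_j(0) + I(0) + R(0) = 1. Then the solution converges as t → ∞ to the endemic equilibrium (S*, E_n*, ..., E_1*, I*, R*), the unique equilibrium of the system with all components strictly positive, in which S* = 1/R_0 and I* = (μ/β̄)·(R_0 − 1). -/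
open Filter Topology

/-- The algebraic equilibrium system of the Coxian distributed SEIR model
with constant contact rate `β`. -/
def CoxianEquilib (n : ℕ) (μ γ β : ℝ) (lam p : ℕ → ℝ)
    (S : ℝ) (E : ℕ → ℝ) (I R : ℝ) : Prop :=
  μ - β * S * I - μ * S = 0 ∧
  β * S * I - (lam n + μ) * E n = 0 ∧
  (∀ i, 1 ≤ i → i ≤ n - 1 → (1 - p i) * lam (i + 1) * E (i + 1) - (lam i + μ) * E i = 0) ∧
  (∑ i ∈ Finset.range n, p i * lam (i + 1) * E (i + 1)) - (γ + μ) * I = 0 ∧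
  γ * I - μ * R = 0

/-- All components of an equilibrium are strictly positive. -/
def CoxianPos (n : ℕ) (S : ℝ) (E : ℕ → ℝ) (I R : ℝ) : Prop :=
  0 < S ∧ (∀ i, 1 ≤ i → i ≤ n → 0 < E i) ∧ 0 < I ∧ 0 < R


lemma cx_abel (m : ℕ) (P Q a x : ℕ → ℝ) (h0 : a 0 = Q 0)
    (h : ∀ j, j < m → a (j+1) = P j + Q (j+1)) :
    ∑ j ∈ Finset.range m, (P j * x (j+1) - a j * x j) + ∑ j ∈ Finset.range (m+1), Q j * x j
      = a m * x m := by
  induction m with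
  | zero => simp [h0]
  | succ m ih =>
    have := ih (fun j hj => h j (by omega))
    rw [Finset.sum_range_succ, Finset.sum_range_succ _ (m+1), h m (by omega)]
    linarith

lemma cx_log (y ys x xs : ℝ) (hy : 0 < y) (hys : 0 < ys) (hx : 0 < x) (hxs : 0 < xs) :
    ys * (1 + Real.log (y/ys) - Real.log (x/xs)) ≤ y * xs / x := by
  have h1 : Real.log ((y/ys)/(x/xs)) ≤ (y/ys)/(x/xs) - 1 :=
    Real.log_le_sub_one_of_pos (by positivity)
  rw [Real.log_div (by positivity) (by positivity)] at h1
  have h2 : y * xs / x = ys * ((y/ys)/(x/xs)) := by field_simp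
  rw [h2]
  apply mul_le_mul_of_nonneg_left _ hys.le
  linarith

lemma cx_lyap (m : ℕ) (P Q k c x xs : ℕ → ℝ) (μ β d cI S Ss I Is : ℝ)
    (hβ : 0 < β)
    (hP : ∀ j, j < m → 0 < P j) (hQ : ∀ j, j ≤ m → 0 < Q j)
    (hc : ∀ j, j ≤ m → 0 < c j) (hcI : 0 < cI)
    (hx : ∀ j, j ≤ m → 0 < x j) (hxs : ∀ j, j ≤ m → 0 < xs j)
    (hS : 0 < S) (hSs : 0 < Ss) (hI : 0 < I) (hIs : 0 < Is)
    (hc0 : c 0 * k 0 = cI * Q 0)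
    (hcs : ∀ j, j < m → c (j+1) * k (j+1) = c j * P j + cI * Q (j+1))
    (hcm : c m = 1) (hcd : cI * d = β * Ss)
    (e1 : μ - β * Ss * Is - μ * Ss = 0) (e2 : β * Ss * Is - k m * xs m = 0)
    (e3 : ∀ j, j < m → P j * xs (j+1) - k j * xs j = 0)
    (e4 : ∑ j ∈ Finset.range (m+1), Q j * xs j - d * Is = 0) :
    (1 - Ss / S) * (μ - β * S * I - μ * S)
      + ∑ j ∈ Finset.range m, c j * ((1 - xs j / x j) * (P j * x (j+1) - k j * x j))
      + (1 - xs m / x m) * (β * S * I - k m * x m)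
      + cI * ((1 - Is / I) * (∑ j ∈ Finset.range (m+1), Q j * x j - d * I))
      ≤ - (μ * (S - Ss)^2 / S) := by
  set ℓ : ℕ → ℝ := fun j => Real.log (x j / xs j) with hℓ
  set lS := Real.log (S / Ss) with hlS
  set lI := Real.log (I / Is) with hlI
  have A1 := cx_abel m (fun j => c j * P j) (fun j => cI * Q j) (fun j => c j * k j) x hc0 hcs
  have A2 := cx_abel m (fun j => c j * k j * xs j) (fun j => cI * Q j * xs j)
    (fun j => c j * k j * xs j) ℓ (by simp only [hc0]) (by
      intro j hj
      have := e3 j hj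
      simp only [hcs j hj]
      linear_combination (c j) * this)
  have B1 : (1 - Ss / S) * (μ - β * S * I - μ * S) ≤ - (μ * (S - Ss)^2 / S)
      + β * Ss * Is - β * S * I - β * Ss * Is * (1 - lS) + β * Ss * I := by
    have h := cx_log Ss Ss S Ss hSs hSs hS hSs
    rw [div_self hSs.ne', Real.log_one] at h
    have h' := mul_le_mul_of_nonneg_left h (by positivity : 0 ≤ β * Is)
    have hmu : μ = β * Ss * Is + μ * Ss := by linarith
    have : (1 - Ss / S) * (μ - β * S * I - μ * S) = - (μ * (S - Ss)^2 / S)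
      + β * Ss * Is - β * S * I - β * Is * (Ss * Ss / S) + β * Ss * I := by
      have h3 : (μ - β * S * I - μ * S) = β * Ss * Is + μ * Ss - β * S * I - μ * S := by linarith
      rw [h3]
      field_simp
      ring
    rw [this]
    nlinarith [h']
  have B2 : ∑ j ∈ Finset.range m, c j * ((1 - xs j / x j) * (P j * x (j+1) - k j * x j)) ≤
      ∑ j ∈ Finset.range m, (c j * P j * x (j+1) - c j * k j * x j)
      - ∑ j ∈ Finset.range m, (c j * k j * xs j * ℓ (j+1) - c j * k j * xs j * ℓ j) := by
    rw [← Finset.sum_sub_distrib]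
    apply Finset.sum_le_sum
    intro j hj
    have hj : j < m := Finset.mem_range.1 hj
    have hxj := hx j hj.le
    have h := cx_log (x (j+1)) (xs (j+1)) (x j) (xs j) (hx _ (by omega)) (hxs _ (by omega))
      hxj (hxs _ hj.le)
    have h' := mul_le_mul_of_nonneg_left h (mul_pos (hc j hj.le) (hP j hj)).le
    have e := e3 j hj
    have : c j * ((1 - xs j / x j) * (P j * x (j+1) - k j * x j)) =
      c j * P j * x (j+1) - c j * k j * x j + c j * k j * xs j
        - c j * P j * (x (j+1) * xs j / x j) := by
      field_simp
      ring
    rw [this]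
    have e' : c j * k j * xs j = c j * P j * xs (j+1) := by linear_combination (-c j) * e
    rw [e']
    simp only [hℓ]
    linarith
  have B3 : (1 - xs m / x m) * (β * S * I - k m * x m) ≤ β * S * I - k m * x m
      + β * Ss * Is - β * Ss * Is * (1 + lS + lI - ℓ m) := by
    have hxm := hx m le_rfl
    have h := cx_log (S * I) (Ss * Is) (x m) (xs m) (by positivity) (by positivity) hxm
      (hxs m le_rfl)
    have h' := mul_le_mul_of_nonneg_left h hβ.le
    have hl : Real.log (S * I / (Ss * Is)) = lS + lI := by
      rw [mul_div_mul_comm, Real.log_mul (by positivity) (by positivity)]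
    rw [hl] at h'
    have : (1 - xs m / x m) * (β * S * I - k m * x m) = β * S * I - k m * x m + k m * xs m
        - β * (S * I * xs m / x m) := by
      field_simp
      ring
    rw [this]
    simp only [hℓ]
    linarith
  have B4 : cI * ((1 - Is / I) * (∑ j ∈ Finset.range (m+1), Q j * x j - d * I)) ≤
      ∑ j ∈ Finset.range (m+1), cI * Q j * x j - β * Ss * I + β * Ss * Is
      - β * Ss * Is * (1 - lI) - ∑ j ∈ Finset.range (m+1), cI * Q j * xs j * ℓ j := by
    have hs : ∑ j ∈ Finset.range (m+1), (cI * Q j * xs j * (1 - lI) + cI * Q j * xs j * ℓ j) ≤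
        ∑ j ∈ Finset.range (m+1), cI * (Is / I) * (Q j * x j) := by
      apply Finset.sum_le_sum
      intro j hj
      have hj : j ≤ m := by have := Finset.mem_range.1 hj; omega
      have h := cx_log (x j) (xs j) I Is (hx j hj) (hxs j hj) hI hIs
      have h' := mul_le_mul_of_nonneg_left h (mul_pos hcI (hQ j hj)).le
      have : cI * (Is / I) * (Q j * x j) = cI * Q j * (x j * Is / I) := by ring
      rw [this]
      simp only [hℓ]
      linarith
    rw [Finset.sum_add_distrib, ← Finset.sum_mul, ← Finset.mul_sum] at hs
    have h5 : ∑ j ∈ Finset.range (m+1), cI * Q j * xs j = β * Ss * Is := by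
      simp only [mul_assoc cI]
      rw [← Finset.mul_sum]
      linear_combination cI * e4 + Is * hcd
    rw [h5] at hs
    have h6 : ∑ j ∈ Finset.range (m+1), cI * Q j * x j
        = cI * ∑ j ∈ Finset.range (m+1), Q j * x j := by
      simp only [mul_assoc cI]
      rw [← Finset.mul_sum]
    rw [h6]
    have : cI * ((1 - Is / I) * (∑ j ∈ Finset.range (m+1), Q j * x j - d * I)) =
      cI * ∑ j ∈ Finset.range (m+1), Q j * x j - (cI * d) * I + (cI * d) * Is
       - cI * (Is / I) * ∑ j ∈ Finset.range (m+1), Q j * x j := by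
      field_simp
      ring
    rw [this, hcd]
    linarith
  simp only [hcm, one_mul] at A1 A2
  have e2' : k m * xs m * ℓ m = β * Ss * Is * ℓ m := by linear_combination (- ℓ m) * e2
  linarith

lemma cx_mvt (f f' : ℝ → ℝ) (hf : ∀ t, 0 ≤ t → HasDerivAt f (f' t) t) (s t : ℝ) (hs : 0 ≤ s)
    (hst : s < t) : ∃ c, s < c ∧ c < t ∧ f t - f s = f' c * (t - s) := by
  obtain ⟨c, hc, h⟩ := exists_hasDerivAt_eq_slope f f' hst
    (fun u hu => (hf u (hs.trans hu.1)).continuousAt.continuousWithinAt)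
    (fun u hu => hf u (hs.trans hu.1.le))
  refine ⟨c, hc.1, hc.2, ?_⟩
  rw [h, div_mul_cancel₀ _ (by linarith)]

lemma cx_lip (f f' : ℝ → ℝ) (K : ℝ) (hf : ∀ t, 0 ≤ t → HasDerivAt f (f' t) t)
    (hK : ∀ t, 0 ≤ t → |f' t| ≤ K) (s t : ℝ) (hs : 0 ≤ s) (hst : s ≤ t) :
    |f t - f s| ≤ K * (t - s) := by
  rcases hst.eq_or_lt with rfl | hlt
  · simp
  · obtain ⟨c, h1, h2, h⟩ := cx_mvt f f' hf s t hs hlt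
    rw [h, abs_mul, abs_of_pos (sub_pos.2 hlt)]
    exact mul_le_mul_of_nonneg_right (hK c (by linarith)) (by linarith)

lemma cx_barb (L L' g : ℝ → ℝ) (l K : ℝ) (hL : ∀ t, 0 ≤ t → HasDerivAt L (L' t) t)
    (hle : ∀ t, 0 ≤ t → L' t ≤ - g t) (hlim : Tendsto L atTop (𝓝 l)) (hK : 0 < K)
    (hg : ∀ s t, 0 ≤ s → s ≤ t → |g t - g s| ≤ K * (t - s)) (ε : ℝ) (hε : 0 < ε) :
    ∀ᶠ t in atTop, g t < ε := by
  set δ := ε / (2 * K) with hδ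
  have hδ0 : 0 < δ := by positivity
  have h1 : Tendsto (fun t => L t - L (t + δ)) atTop (𝓝 (l - l)) :=
    hlim.sub (hlim.comp (tendsto_atTop_add_const_right _ _ tendsto_id))
  rw [sub_self] at h1
  have h2 := h1.eventually_lt_const (show (0:ℝ) < δ * (ε/2) by positivity)
  filter_upwards [h2, eventually_ge_atTop 0] with t ht ht0
  by_contra! hge
  obtain ⟨c, hc1, hc2, h⟩ := cx_mvt L L' hL t (t+δ) ht0 (by linarith)
  have h3 := hle c (by linarith)
  have h4 := (abs_le.1 (hg t c ht0 hc1.le)).1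
  have h5 : K * (c - t) ≤ K * δ := mul_le_mul_of_nonneg_left (by linarith) hK.le
  have h6 : K * δ = ε / 2 := by rw [hδ]; field_simp
  have h7 : L' c ≤ -(ε/2) := by linarith
  have h8 : L' c * (t + δ - t) ≤ -(ε/2) * δ := by
    rw [add_sub_cancel_left]
    exact mul_le_mul_of_nonneg_right h7 hδ0.le
  linarith

lemma cx_exp_mono (x x' : ℝ → ℝ) (k : ℝ) (T s : ℝ) (hs : 0 ≤ s)
    (hx : ∀ t, 0 ≤ t → HasDerivAt x (x' t) t) (hst : s ≤ T)
    (h : ∀ t, s < t → t < T → - k * x t ≤ x' t) :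
    x s * Real.exp (k * s) ≤ x T * Real.exp (k * T) := by
  rcases hst.eq_or_lt with rfl | hlt
  · rfl
  have hd : ∀ t, 0 ≤ t → HasDerivAt (fun t => x t * Real.exp (k * t))
      (x' t * Real.exp (k * t) + x t * (Real.exp (k * t) * k)) t := by
    intro t ht
    have h1 : HasDerivAt (fun t => k * t) k t := by
      simpa using (hasDerivAt_id t).const_mul k
    exact (hx t ht).mul h1.exp
  obtain ⟨c, hc1, hc2, he⟩ := cx_mvt _ _ hd s T hs hlt
  have := h c hc1 hc2
  have h2 : 0 ≤ (x' c * Real.exp (k * c) + x c * (Real.exp (k * c) * k)) * (T - s) := by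
    apply mul_nonneg _ (by linarith)
    have : 0 ≤ (x' c + k * x c) * Real.exp (k * c) := mul_nonneg (by linarith) (Real.exp_pos _).le
    linarith
  linarith

lemma cx_pos {ι : Type} (s : Finset ι) (X X' : ι → ℝ → ℝ)
    (hd : ∀ i ∈ s, ∀ t, 0 ≤ t → HasDerivAt (X i) (X' i t) t) (h0 : ∀ i ∈ s, 0 < X i 0)
    (hb : ∀ T, 0 < T → ∀ i ∈ s, ∃ k, ∀ t, 0 ≤ t → t ≤ T → (∀ j ∈ s, 0 < X j t) →
      - k * X i t ≤ X' i t) :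
    ∀ t, 0 ≤ t → ∀ i ∈ s, 0 < X i t := by
  by_contra! hcon
  obtain ⟨t1, ht1, i1, hi1, hx1⟩ := hcon
  set A : Set ℝ := ⋃ i ∈ s, {t | 0 ≤ t ∧ X i t ≤ 0} with hA
  have hAc : IsClosed A := by
    apply isClosed_biUnion_finset
    intro i hi
    have hc : ContinuousOn (X i) (Set.Ici 0) := fun t ht =>
      (hd i hi t ht).continuousAt.continuousWithinAt
    have := hc.preimage_isClosed_of_isClosed isClosed_Ici (isClosed_Iic (a := (0:ℝ)))
    exact this
  have hAb : BddBelow A := ⟨0, by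
    intro t ht
    simp only [hA, Set.mem_iUnion] at ht
    obtain ⟨i, hi, h⟩ := ht
    exact h.1⟩
  have hAn : A.Nonempty := ⟨t1, by
    simp only [hA, Set.mem_iUnion]
    exact ⟨i1, hi1, ht1, hx1⟩⟩
  have hT := hAc.csInf_mem hAn hAb
  set T := sInf A
  have hT' := hT
  simp only [hA, Set.mem_iUnion] at hT'
  obtain ⟨i, hi, hT0, hXT⟩ := hT'
  have hlt : ∀ t, 0 ≤ t → t < T → ∀ j ∈ s, 0 < X j t := by
    intro t ht htT j hj
    by_contra! hle
    have : t ∈ A := by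
      simp only [hA, Set.mem_iUnion]
      exact ⟨j, hj, ht, hle⟩
    have := csInf_le hAb this
    exact absurd this (not_le.2 htT)
  have hTp : 0 < T := by
    rcases hT0.eq_or_lt with h | h
    · rw [← h] at hXT
      exact absurd (h0 i hi) (not_lt.2 hXT)
    · exact h
  obtain ⟨k, hk⟩ := hb T hTp i hi
  have := cx_exp_mono (X i) (X' i) k T 0 le_rfl (hd i hi) hT0
    (fun t h1 h2 => hk t h1.le h2.le (hlt t h1.le h2))
  have h1 : 0 < X i 0 * Real.exp (k * 0) := mul_pos (h0 i hi) (Real.exp_pos _)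
  have h2 : X i T * Real.exp (k * T) ≤ 0 := mul_nonpos_of_nonpos_of_nonneg hXT (Real.exp_pos _).le
  linarith

lemma cx_pos1 (X X' : ℝ → ℝ)
    (hd : ∀ t, 0 ≤ t → HasDerivAt X (X' t) t) (h0 : 0 < X 0)
    (hb : ∀ T, 0 < T → ∃ k, ∀ t, 0 ≤ t → t ≤ T → 0 < X t → - k * X t ≤ X' t) :
    ∀ t, 0 ≤ t → 0 < X t := by
  intro t ht
  refine cx_pos (ι := Unit) {()} (fun _ => X) (fun _ => X') (fun _ _ => hd) (fun _ _ => h0) ?_ t ht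
    () (by simp)
  intro T hT i _
  obtain ⟨k, hk⟩ := hb T hT
  exact ⟨k, fun t h1 h2 h3 => hk t h1 h2 (h3 () (by simp))⟩

lemma cx_filter_low (x a : ℝ → ℝ) (k l : ℝ) (hk : 0 < k)
    (hx : ∀ t, 0 ≤ t → HasDerivAt x (a t - k * x t) t) (ha : Tendsto a atTop (𝓝 (k * l)))
    (ε : ℝ) (hε : 0 < ε) : ∀ᶠ t in atTop, l - ε < x t := by
  have h1 := ha.eventually_const_lt (show k * (l - ε/2) < k * l by nlinarith)
  obtain ⟨T0, hT0⟩ := eventually_atTop.1 h1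
  set T := max T0 0
  have hT : 0 ≤ T := le_max_right _ _
  have h2 : ∀ t, T ≤ t → (x T - (l - ε/2)) * Real.exp (k * T) ≤
      (x t - (l - ε/2)) * Real.exp (k * t) := by
    intro t ht
    refine cx_exp_mono (fun t => x t - (l - ε/2)) (fun t => a t - k * x t) k t T hT
      (fun u hu => (hx u hu).sub_const _) ht ?_
    intro u hu _
    have := hT0 u (le_trans (le_max_left _ _) hu.le)
    linarith
  have h3 : Tendsto (fun t => (x T - (l - ε/2)) * Real.exp (k * T) * Real.exp (-(k * t))) atTop
      (𝓝 ((x T - (l - ε/2)) * Real.exp (k * T) * 0)) :=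
    (Real.tendsto_exp_neg_atTop_nhds_zero.comp (tendsto_id.const_mul_atTop hk)).const_mul _
  rw [mul_zero] at h3
  have h4 := h3.eventually_const_lt (show -(ε/2) < 0 by linarith)
  filter_upwards [h4, eventually_ge_atTop T] with t ht htT
  have h5 := mul_le_mul_of_nonneg_right (h2 t htT) (Real.exp_pos (-(k*t))).le
  rw [mul_assoc (x t - _), ← Real.exp_add, add_neg_cancel, Real.exp_zero] at h5
  linarith

lemma cx_filter (x a : ℝ → ℝ) (k l : ℝ) (hk : 0 < k)
    (hx : ∀ t, 0 ≤ t → HasDerivAt x (a t - k * x t) t) (ha : Tendsto a atTop (𝓝 (k * l))) :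
    Tendsto x atTop (𝓝 l) := by
  rw [Metric.tendsto_nhds]
  intro ε hε
  have h1 := cx_filter_low x a k l hk hx ha ε hε
  have h2 := cx_filter_low (fun t => - x t) (fun t => - a t) k (-l) hk
    (fun t ht => (hx t ht).neg.congr_deriv (by ring)) (by simpa using ha.neg) ε hε
  filter_upwards [h1, h2] with t h1 h2
  rw [Real.dist_eq, abs_lt]
  constructor <;> linarith

lemma cx_weights (m : ℕ) (P Q k : ℕ → ℝ) (cI : ℝ) (hcI : 0 < cI)
    (hP : ∀ j, j < m → 0 < P j) (hQ : ∀ j, j ≤ m → 0 < Q j) (hk : ∀ j, j ≤ m → 0 < k j) :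
    ∃ c : ℕ → ℝ, (∀ j, j ≤ m → 0 < c j) ∧ c 0 * k 0 = cI * Q 0 ∧
      ∀ j, j < m → c (j+1) * k (j+1) = c j * P j + cI * Q (j+1) := by
  refine ⟨fun j => Nat.rec (cI * Q 0 / k 0) (fun j cj => (cj * P j + cI * Q (j+1)) / k (j+1)) j,
    ?_, ?_, ?_⟩
  · intro j
    induction j with
    | zero => intro hj; exact div_pos (mul_pos hcI (hQ 0 hj)) (hk 0 hj)
    | succ j ih =>
      intro hj
      exact div_pos (add_pos (mul_pos (ih (by omega)) (hP j (by omega)))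
        (mul_pos hcI (hQ _ hj))) (hk _ hj)
  · exact div_mul_cancel₀ _ (hk 0 (by omega)).ne'
  · intro j hj
    exact div_mul_cancel₀ _ (hk (j+1) (by omega)).ne'

lemma cx_cm (m : ℕ) (P Q k c xs : ℕ → ℝ) (β d cI Ss Is : ℝ)
    (hc0 : c 0 * k 0 = cI * Q 0)
    (hcs : ∀ j, j < m → c (j+1) * k (j+1) = c j * P j + cI * Q (j+1))
    (e2 : β * Ss * Is - k m * xs m = 0)
    (e3 : ∀ j, j < m → P j * xs (j+1) - k j * xs j = 0)
    (e4 : ∑ j ∈ Finset.range (m+1), Q j * xs j - d * Is = 0) :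
    c m * (β * Ss * Is) = cI * d * Is := by
  have A1 := cx_abel m (fun j => c j * P j) (fun j => cI * Q j) (fun j => c j * k j) xs hc0 hcs
  have h : ∑ j ∈ Finset.range m, (c j * P j * xs (j+1) - c j * k j * xs j) = 0 := by
    apply Finset.sum_eq_zero
    intro j hj
    linear_combination c j * e3 j (Finset.mem_range.1 hj)
  rw [h] at A1
  simp only [mul_assoc cI] at A1
  rw [← Finset.mul_sum] at A1
  linear_combination (-1) * A1 + cI * e4 + c m * e2

lemma cx_core (m : ℕ) (P Q k xs : ℕ → ℝ) (μ β d Ss Is : ℝ) (S I : ℝ → ℝ) (x : ℕ → ℝ → ℝ)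
    (hμ : 0 < μ) (hβ : 0 < β) (hd : 0 < d)
    (hP : ∀ j, j < m → 0 < P j) (hQ : ∀ j, j ≤ m → 0 < Q j) (hk : ∀ j, j ≤ m → 0 < k j)
    (hxs : ∀ j, j ≤ m → 0 < xs j) (hSs : 0 < Ss) (hIs : 0 < Is)
    (e1 : μ - β * Ss * Is - μ * Ss = 0) (e2 : β * Ss * Is - k m * xs m = 0)
    (e3 : ∀ j, j < m → P j * xs (j+1) - k j * xs j = 0)
    (e4 : ∑ j ∈ Finset.range (m+1), Q j * xs j - d * Is = 0)
    (hS : ∀ t, 0 ≤ t → HasDerivAt S (μ - β * S t * I t - μ * S t) t)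
    (hxm : ∀ t, 0 ≤ t → HasDerivAt (x m) (β * S t * I t - k m * x m t) t)
    (hx : ∀ j, j < m → ∀ t, 0 ≤ t → HasDerivAt (x j) (P j * x (j+1) t - k j * x j t) t)
    (hI : ∀ t, 0 ≤ t → HasDerivAt I (∑ j ∈ Finset.range (m+1), Q j * x j t - d * I t) t)
    (bS : ∀ t, 0 ≤ t → 0 < S t ∧ S t ≤ 2) (bI : ∀ t, 0 ≤ t → 0 < I t ∧ I t ≤ 2)
    (bx : ∀ j, j ≤ m → ∀ t, 0 ≤ t → 0 < x j t ∧ x j t ≤ 2) :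
    Tendsto S atTop (𝓝 Ss) ∧ Tendsto I atTop (𝓝 Is) := by
  set cI := β * Ss / d with hcIdef
  have hcI : 0 < cI := by positivity
  have hcd : cI * d = β * Ss := by rw [hcIdef]; field_simp
  obtain ⟨c, hc, hc0, hcs⟩ := cx_weights m P Q k cI hcI hP hQ hk
  have hcm : c m = 1 := by
    have h := cx_cm m P Q k c xs β d cI Ss Is hc0 hcs e2 e3 e4
    rw [hcd] at h
    have h2 : β * Ss * Is ≠ 0 := by positivity
    field_simp at h
    exact h
  set L : ℝ → ℝ := fun t => (S t - Ss * Real.log (S t))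
    + ∑ j ∈ Finset.range m, c j * (x j t - xs j * Real.log (x j t))
    + (x m t - xs m * Real.log (x m t)) + cI * (I t - Is * Real.log (I t)) with hLdef
  set L' : ℝ → ℝ := fun t => (1 - Ss / S t) * (μ - β * S t * I t - μ * S t)
      + ∑ j ∈ Finset.range m, c j * ((1 - xs j / x j t) * (P j * x (j+1) t - k j * x j t))
      + (1 - xs m / x m t) * (β * S t * I t - k m * x m t)
      + cI * ((1 - Is / I t) * (∑ j ∈ Finset.range (m+1), Q j * x j t - d * I t)) with hL'def
  have hvol : ∀ (y y' : ℝ → ℝ) (ys : ℝ) (t : ℝ), HasDerivAt y (y' t) t → 0 < y t →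
      HasDerivAt (fun t => y t - ys * Real.log (y t)) ((1 - ys / y t) * y' t) t := by
    intro y y' ys t h h0
    have := h.sub ((h.log h0.ne').const_mul ys)
    exact this.congr_deriv (by ring)
  have hL : ∀ t, 0 ≤ t → HasDerivAt L (L' t) t := by
    intro t ht
    have hsum : HasDerivAt (fun t => ∑ j ∈ Finset.range m, c j * (x j t - xs j * Real.log (x j t)))
        (∑ j ∈ Finset.range m, c j * ((1 - xs j / x j t) * (P j * x (j+1) t - k j * x j t))) t := by
      apply HasDerivAt.fun_sum
      intro j hj
      have hj := Finset.mem_range.1 hj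
      exact (hvol (x j) (fun t => P j * x (j+1) t - k j * x j t) (xs j) t (hx j hj t ht)
        (bx j hj.le t ht).1).const_mul _
    exact (((hvol S (fun t => μ - β * S t * I t - μ * S t) Ss t (hS t ht) (bS t ht).1).add
      hsum).add (hvol (x m) (fun t => β * S t * I t - k m * x m t) _ t (hxm t ht)
      (bx m le_rfl t ht).1)).add ((hvol I
        (fun t => ∑ j ∈ Finset.range (m+1), Q j * x j t - d * I t) _ t (hI t ht)
        (bI t ht).1).const_mul _)
  set g : ℝ → ℝ := fun t => μ / 2 * (S t - Ss)^2 with hgdef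
  have hle : ∀ t, 0 ≤ t → L' t ≤ - g t := by
    intro t ht
    have h := cx_lyap m P Q k c (fun j => x j t) xs μ β d cI (S t) Ss (I t) Is hβ hP hQ hc hcI
      (fun j hj => (bx j hj t ht).1) hxs (bS t ht).1 hSs (bI t ht).1 hIs hc0 hcs hcm hcd e1 e2 e3 e4
    refine h.trans (neg_le_neg ?_)
    have := bS t ht
    rw [hgdef, le_div_iff₀ this.1]
    have h2 : 0 ≤ μ * (S t - Ss)^2 := by positivity
    simp only
    nlinarith
  have hvb : ∀ y ys : ℝ, 0 < y → 0 < ys → ys - ys * Real.log ys ≤ y - ys * Real.log y := by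
    intro y ys hy hys
    have := Real.log_le_sub_one_of_pos (div_pos hy hys)
    rw [Real.log_div hy.ne' hys.ne'] at this
    have h2 := mul_le_mul_of_nonneg_left this hys.le
    have h3 : ys * (y / ys - 1) = y - ys := by field_simp
    rw [h3] at h2
    linarith
  have hLb : ∃ b, ∀ t, 0 ≤ t → b ≤ L t := by
    refine ⟨(Ss - Ss * Real.log Ss)
      + ∑ j ∈ Finset.range m, c j * (xs j - xs j * Real.log (xs j))
      + (xs m - xs m * Real.log (xs m)) + cI * (Is - Is * Real.log Is), ?_⟩
    intro t ht
    refine add_le_add (add_le_add (add_le_add (hvb _ _ (bS t ht).1 hSs) ?_)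
      (hvb _ _ (bx m le_rfl t ht).1 (hxs m le_rfl)))
      (mul_le_mul_of_nonneg_left (hvb _ _ (bI t ht).1 hIs) hcI.le)
    apply Finset.sum_le_sum
    intro j hj
    have hj := Finset.mem_range.1 hj
    exact mul_le_mul_of_nonneg_left (hvb _ _ (bx j hj.le t ht).1 (hxs j hj.le)) (hc j hj.le).le
  obtain ⟨l, hl⟩ : ∃ l, Tendsto L atTop (𝓝 l) := by
    have hanti : Antitone (fun t => L (max t 0)) := by
      intro a b hab
      have hab' : max a 0 ≤ max b 0 := max_le_max hab le_rfl
      rcases hab'.eq_or_lt with h | h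
      · simp only [h]; exact le_rfl
      obtain ⟨u, h1, h2, h3⟩ := cx_mvt L L' hL (max a 0) (max b 0) (le_max_right _ _) h
      have hu : 0 ≤ u := (le_max_right a 0).trans h1.le
      have h4 : L' u ≤ 0 := (hle u hu).trans (by simp only [hgdef]; rw [neg_nonpos]; positivity)
      have := mul_nonpos_of_nonpos_of_nonneg h4 (by linarith : 0 ≤ max b 0 - max a 0)
      simp only
      linarith
    obtain ⟨b, hb⟩ := hLb
    have := tendsto_atTop_ciInf hanti ⟨b, by
      rintro _ ⟨t, rfl⟩
      exact hb _ (le_max_right _ _)⟩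
    refine ⟨_, this.congr' ?_⟩
    filter_upwards [eventually_ge_atTop 0] with t ht
    rw [max_eq_left ht]
  -- bounds on derivatives
  set K1 := 5 * μ + 4 * β + 1 with hK1
  have bS' : ∀ t, 0 ≤ t → |μ - β * S t * I t - μ * S t| ≤ K1 := by
    intro t ht
    have h1 := bS t ht
    have h2 := bI t ht
    have h3 : 0 < S t * I t := mul_pos h1.1 h2.1
    have h4 : S t * I t ≤ 4 := by nlinarith
    rw [abs_le]
    constructor <;> nlinarith
  set K2 := ∑ j ∈ Finset.range (m+1), Q j * 2 + 2 * d with hK2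
  have bI' : ∀ t, 0 ≤ t → |∑ j ∈ Finset.range (m+1), Q j * x j t - d * I t| ≤ K2 := by
    intro t ht
    have h2 := bI t ht
    have h3 : ∑ j ∈ Finset.range (m+1), Q j * x j t ≤ ∑ j ∈ Finset.range (m+1), Q j * 2 := by
      apply Finset.sum_le_sum
      intro j hj
      have hj : j ≤ m := by have := Finset.mem_range.1 hj; omega
      exact mul_le_mul_of_nonneg_left (bx j hj t ht).2 (hQ j hj).le
    have h4 : 0 ≤ ∑ j ∈ Finset.range (m+1), Q j * x j t := by
      apply Finset.sum_nonneg
      intro j hj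
      have hj : j ≤ m := by have := Finset.mem_range.1 hj; omega
      exact (mul_pos (hQ j hj) (bx j hj t ht).1).le
    rw [abs_le]
    constructor <;> nlinarith
  have hK1p : 0 < K1 := by positivity
  have hK2p : 0 ≤ K2 := (abs_nonneg _).trans (bI' 0 le_rfl)
  -- S converges
  have hgd : ∀ t, 0 ≤ t → HasDerivAt g (μ * (S t - Ss) * (μ - β * S t * I t - μ * S t)) t := by
    intro t ht
    have := (((hS t ht).sub_const Ss).pow 2).const_mul (μ/2)
    exact this.congr_deriv (by push_cast; ring)
  have hgl := cx_lip g _ (μ * (2 + Ss) * K1) hgd (by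
    intro t ht
    rw [abs_mul, abs_mul, abs_of_pos hμ]
    have h1 := bS t ht
    have h2 : |S t - Ss| ≤ 2 + Ss := by rw [abs_le]; constructor <;> linarith
    have := bS' t ht
    gcongr)
  have hg0 := cx_barb L L' g l (μ * (2 + Ss) * K1) hL hle hl (by positivity) hgl
  have hSlim : Tendsto S atTop (𝓝 Ss) := by
    rw [Metric.tendsto_nhds]
    intro ε hε
    filter_upwards [hg0 (μ / 2 * ε^2) (by positivity)] with t ht
    rw [Real.dist_eq]
    have : (S t - Ss)^2 < ε^2 := lt_of_mul_lt_mul_left ht (by positivity)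
    exact abs_lt_of_sq_lt_sq this hε.le
  refine ⟨hSlim, ?_⟩
  set D : ℝ → ℝ := fun t => μ - β * S t * I t - μ * S t with hD
  set D' : ℝ → ℝ := fun t => -(β * (D t * I t + S t * (∑ j ∈ Finset.range (m+1), Q j * x j t - d * I t)))
    - μ * D t with hD'
  have hDd : ∀ t, 0 ≤ t → HasDerivAt D (D' t) t := by
    intro t ht
    have h1 := (hasDerivAt_const t μ).sub (((hS t ht).const_mul β).mul (hI t ht))
    have := h1.sub ((hS t ht).const_mul μ)
    exact this.congr_deriv (by simp only [hD', hD]; ring)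
  set K3 := β * (K1 * 2 + 2 * K2) + μ * K1 with hK3
  have hK3p : 0 < K3 := by positivity
  have hDl := cx_lip D D' K3 hDd (by
    intro t ht
    have h1 : |D t| ≤ K1 := bS' t ht
    have h2 := bI' t ht
    have h3 : |S t| ≤ 2 := by rw [abs_of_pos (bS t ht).1]; exact (bS t ht).2
    have h4 : |I t| ≤ 2 := by rw [abs_of_pos (bI t ht).1]; exact (bI t ht).2
    calc |D' t| ≤ |-(β * (D t * I t + S t * (∑ j ∈ Finset.range (m+1), Q j * x j t - d * I t)))|
            + |μ * D t| := abs_sub _ _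
      _ ≤ β * (|D t| * |I t| + |S t| * |∑ j ∈ Finset.range (m+1), Q j * x j t - d * I t|)
            + μ * |D t| := by
          rw [abs_neg, abs_mul, abs_mul, abs_of_pos hβ, abs_of_pos hμ]
          gcongr
          refine (abs_add_le _ _).trans ?_
          rw [abs_mul, abs_mul]
      _ ≤ K3 := by rw [hK3]; gcongr)
  have hDlim : Tendsto D atTop (𝓝 0) := by
    rw [Metric.tendsto_nhds]
    intro ε hε
    have h1 := cx_barb S D (fun t => - D t) Ss K3 hS (fun t _ => by simp) hSlim hK3p
      (fun s t hs hst => by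
        have := hDl s t hs hst
        rwa [neg_sub_neg, abs_sub_comm]) ε hε
    have h2 := cx_barb (fun t => - S t) (fun t => - D t) D (-Ss) K3 (fun t ht => (hS t ht).neg)
      (fun t _ => le_rfl) hSlim.neg hK3p hDl ε hε
    filter_upwards [h1, h2] with t h1 h2
    rw [Real.dist_eq, sub_zero, abs_lt]
    constructor <;> linarith
  have h1 : Tendsto (fun t => (μ - μ * S t - D t) / (β * S t)) atTop
      (𝓝 ((μ - μ * Ss - 0) / (β * Ss))) :=
    ((tendsto_const_nhds.sub (hSlim.const_mul μ)).sub hDlim).div (hSlim.const_mul β)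
      (by positivity)
  have h2 : (μ - μ * Ss - 0) / (β * Ss) = Is := by
    rw [div_eq_iff (by positivity)]; linarith
  rw [h2] at h1
  refine h1.congr' ?_
  filter_upwards [eventually_ge_atTop 0] with t ht
  have := (bS t ht).1
  rw [div_eq_iff (by positivity)]
  simp only [hD]
  ring

lemma cx_term (m i : ℕ) (hi : i ≤ m) (p q : ℕ → ℝ) :
    (p i * ∏ j ∈ Finset.Icc 1 (m + 1 - 1 - i), (1 - p (j + i))) *
        ∏ k ∈ Finset.Icc 1 (m + 1 - i), q (m + 1 + 1 - k)
      = p i * (q (i+1) * ∏ j ∈ Finset.Ico (i+1) (m+1), ((1 - p j) * q (j+1))) := by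
  have h1 : ∏ j ∈ Finset.Icc 1 (m + 1 - 1 - i), (1 - p (j + i))
      = ∏ j ∈ Finset.Ico (i+1) (m+1), (1 - p j) := by
    refine Finset.prod_nbij' (fun j => j + i) (fun j => j - i) ?_ ?_ ?_ ?_ ?_
    · intro j hj; simp only [Finset.mem_Icc, Finset.mem_Ico] at *; omega
    · intro j hj; simp only [Finset.mem_Icc, Finset.mem_Ico] at *; omega
    · intro j hj; simp
    · intro j hj; simp only [Finset.mem_Ico] at *; omega
    · intro j hj; rfl
  have h2 : ∏ k ∈ Finset.Icc 1 (m + 1 - i), q (m + 1 + 1 - k)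
      = ∏ j ∈ Finset.Ico i (m+1), q (j+1) := by
    refine Finset.prod_nbij' (fun j => m + 1 - j) (fun j => m + 1 - j) ?_ ?_ ?_ ?_ ?_
    · intro j hj; simp only [Finset.mem_Icc, Finset.mem_Ico] at *; omega
    · intro j hj; simp only [Finset.mem_Icc, Finset.mem_Ico] at *; omega
    · intro j hj; simp only [Finset.mem_Icc] at *; omega
    · intro j hj; simp only [Finset.mem_Ico] at *; omega
    · intro j hj
      simp only [Finset.mem_Icc] at *
      congr 1
      omega
  rw [h1, h2, Finset.prod_eq_prod_Ico_succ_bot (by omega : i < m + 1), Finset.prod_mul_distrib]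
  ring

/-- Global asymptotic stability of the endemic equilibrium of the Coxian
distributed SEIR model with constant contact rate, when `R0 > 1`. -/
theorem coxian_seir_endemic_global_stability
    (n : ℕ) (hn : 1 ≤ n) (μ γ β : ℝ) (hμ : 0 < μ) (hγ : 0 < γ) (hβ : 0 < β)
    (lam p : ℕ → ℝ) (hlam : ∀ i, 1 ≤ i → i ≤ n → 0 < lam i)
    (hp0 : p 0 = 1) (hp : ∀ i, 1 ≤ i → i ≤ n - 1 → 0 < p i ∧ p i < 1)
    (R0 : ℝ)
    (hR0 : R0 = β / (γ + μ) * ∑ i ∈ Finset.range n,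
      (p i * ∏ j ∈ Finset.Icc 1 (n - 1 - i), (1 - p (j + i))) *
        ∏ k ∈ Finset.Icc 1 (n - i), lam (n + 1 - k) / (lam (n + 1 - k) + μ))
    (S I R : ℝ → ℝ) (E : ℕ → ℝ → ℝ)
    (hS : ∀ t, 0 ≤ t → HasDerivAt S (μ - β * S t * I t - μ * S t) t)
    (hEn : ∀ t, 0 ≤ t → HasDerivAt (E n) (β * S t * I t - (lam n + μ) * E n t) t)
    (hEi : ∀ i, 1 ≤ i → i ≤ n - 1 → ∀ t, 0 ≤ t →
      HasDerivAt (E i) ((1 - p i) * lam (i + 1) * E (i + 1) t - (lam i + μ) * E i t) t)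
    (hI : ∀ t, 0 ≤ t → HasDerivAt I
      ((∑ i ∈ Finset.range n, p i * lam (i + 1) * E (i + 1) t) - (γ + μ) * I t) t)
    (hR : ∀ t, 0 ≤ t → HasDerivAt R (γ * I t - μ * R t) t)
    (hR0gt : 1 < R0)
    (hS0 : 0 < S 0) (hE0 : ∀ i, 1 ≤ i → i ≤ n → 0 < E i 0)
    (hI0 : 0 < I 0) (hRinit : 0 < R 0)
    (hsum : S 0 + (∑ j ∈ Finset.Icc 1 n, E j 0) + I 0 + R 0 = 1) :
    ∃ (Ss : ℝ) (Es : ℕ → ℝ) (Is Rs : ℝ),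
      CoxianEquilib n μ γ β lam p Ss Es Is Rs ∧ CoxianPos n Ss Es Is Rs ∧
      Ss = 1 / R0 ∧ Is = μ / β * (R0 - 1) ∧
      (∀ (S' : ℝ) (E' : ℕ → ℝ) (I' R' : ℝ),
        CoxianEquilib n μ γ β lam p S' E' I' R' → CoxianPos n S' E' I' R' →
        S' = Ss ∧ I' = Is ∧ R' = Rs ∧ ∀ i, 1 ≤ i → i ≤ n → E' i = Es i) ∧
      Tendsto S atTop (𝓝 Ss) ∧
      (∀ i, 1 ≤ i → i ≤ n → Tendsto (E i) atTop (𝓝 (Es i))) ∧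
      Tendsto I atTop (𝓝 Is) ∧ Tendsto R atTop (𝓝 Rs) := by
  obtain ⟨m, rfl⟩ : ∃ m, n = m + 1 := ⟨n - 1, by omega⟩
  simp only [Nat.add_sub_cancel] at hp hEi
  have hd : 0 < γ + μ := by positivity
  have hR0p : 0 < R0 := by linarith
  set Ss := 1 / R0 with hSsd
  set Is := μ / β * (R0 - 1) with hIsd
  have hSs : 0 < Ss := by positivity
  have hIs : 0 < Is := mul_pos (by positivity) (by linarith)
  set B := β * Ss * Is with hB
  have hBp : 0 < B := by positivity
  set q : ℕ → ℝ := fun i => lam i / (lam i + μ) with hq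
  set Es : ℕ → ℝ := fun i => B / (lam i + μ) * ∏ j ∈ Finset.Ico i (m+1), ((1 - p j) * q (j+1))
    with hEs
  have hk : ∀ i, 1 ≤ i → i ≤ m + 1 → 0 < lam i + μ := fun i h1 h2 => by
    have := hlam i h1 h2
    linarith
  have hEsp : ∀ i, 1 ≤ i → i ≤ m + 1 → 0 < Es i := by
    intro i h1 h2
    apply mul_pos (div_pos hBp (hk i h1 h2))
    apply Finset.prod_pos
    intro j hj
    rw [Finset.mem_Ico] at hj
    have := hp j (by omega) (by omega)
    exact mul_pos (by linarith) (div_pos (hlam _ (by omega) (by omega)) (hk _ (by omega) (by omega)))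
  have hpp : ∀ i, i ≤ m → 0 < p i := by
    intro i hi
    rcases Nat.eq_zero_or_pos i with rfl | h
    · rw [hp0]; exact one_pos
    · exact (hp i h hi).1
  have e1 : μ - β * Ss * Is - μ * Ss = 0 := by
    rw [hSsd, hIsd]; field_simp; ring
  have e2 : β * Ss * Is - (lam (m+1) + μ) * Es (m+1) = 0 := by
    have := hk (m+1) (by omega) le_rfl
    simp only [hEs, Finset.Ico_self, Finset.prod_empty]
    field_simp
    rw [hB]; ring
  have e3 : ∀ i, 1 ≤ i → i ≤ m →
      (1 - p i) * lam (i + 1) * Es (i + 1) - (lam i + μ) * Es i = 0 := by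
    intro i h1 h2
    have h3 := hk i h1 (by omega)
    have h4 := hk (i+1) (by omega) (by omega)
    simp only [hEs]
    rw [Finset.prod_eq_prod_Ico_succ_bot (by omega : i < m + 1)]
    simp only [hq]
    field_simp
    ring
  have e4 : (∑ i ∈ Finset.range (m+1), p i * lam (i + 1) * Es (i + 1)) - (γ + μ) * Is = 0 := by
    have h1 : ∑ i ∈ Finset.range (m+1), p i * lam (i + 1) * Es (i + 1) =
        B * ∑ i ∈ Finset.range (m+1),
      (p i * ∏ j ∈ Finset.Icc 1 (m + 1 - 1 - i), (1 - p (j + i))) *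
        ∏ k ∈ Finset.Icc 1 (m + 1 - i), q (m + 1 + 1 - k) := by
      rw [Finset.mul_sum]
      apply Finset.sum_congr rfl
      intro i hi
      have hi : i ≤ m := by have := Finset.mem_range.1 hi; omega
      rw [cx_term m i hi p q]
      simp only [hEs, hq]
      ring
    rw [h1]
    have h2 : R0 = β / (γ + μ) * ∑ i ∈ Finset.range (m+1),
      (p i * ∏ j ∈ Finset.Icc 1 (m + 1 - 1 - i), (1 - p (j + i))) *
        ∏ k ∈ Finset.Icc 1 (m + 1 - i), q (m + 1 + 1 - k) := hR0
    set Sg := ∑ i ∈ Finset.range (m+1),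
      (p i * ∏ j ∈ Finset.Icc 1 (m + 1 - 1 - i), (1 - p (j + i))) *
        ∏ k ∈ Finset.Icc 1 (m + 1 - i), q (m + 1 + 1 - k)
    have h3 : β * Sg = (γ + μ) * R0 := by rw [h2]; field_simp
    have h4 : Ss * R0 = 1 := by rw [hSsd]; field_simp
    rw [hB]
    linear_combination Ss * Is * h3 + (γ + μ) * Is * h4
  -- shifted data
  set P : ℕ → ℝ := fun j => (1 - p (j+1)) * lam (j+2) with hPd
  set Q : ℕ → ℝ := fun j => p j * lam (j+1) with hQd
  set k : ℕ → ℝ := fun j => lam (j+1) + μ with hkd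
  have hP : ∀ j, j < m → 0 < P j := fun j hj => by
    have := hp (j+1) (by omega) (by omega)
    exact mul_pos (by linarith) (hlam _ (by omega) (by omega))
  have hQ : ∀ j, j ≤ m → 0 < Q j := fun j hj =>
    mul_pos (hpp j hj) (hlam _ (by omega) (by omega))
  have hk' : ∀ j, j ≤ m → 0 < k j := fun j hj => hk _ (by omega) (by omega)
  -- positivity
  have hSp : ∀ t, 0 ≤ t → 0 < S t := by
    refine cx_pos1 S _ hS hS0 ?_
    intro T hT
    have hc : ContinuousOn I (Set.Icc 0 T) := fun t ht =>
      (hI t ht.1).continuousAt.continuousWithinAt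
    obtain ⟨C, hC⟩ := isCompact_Icc.exists_bound_of_continuousOn hc
    refine ⟨β * C + μ, fun t h1 h2 h3 => ?_⟩
    have h4 := (abs_le.1 (hC t ⟨h1, h2⟩)).2
    have h5 := mul_le_mul_of_nonneg_left h4 (mul_pos hβ h3).le
    linarith
  have hEIp : ∀ t, 0 ≤ t → ∀ i ∈ Finset.range (m+2), 0 < (if i = 0 then I t else E i t) := by
    have := cx_pos (Finset.range (m+2)) (fun i t => if i = 0 then I t else E i t)
      (fun i t => if i = 0 then
        (∑ i ∈ Finset.range (m+1), p i * lam (i + 1) * E (i + 1) t) - (γ + μ) * I t else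
        if i = m + 1 then β * S t * I t - (lam (m+1) + μ) * E (m+1) t else
        (1 - p i) * lam (i + 1) * E (i + 1) t - (lam i + μ) * E i t) ?_ ?_ ?_
    · exact this
    · intro i hi t ht
      have hi := Finset.mem_range.1 hi
      by_cases h0 : i = 0
      · simp only [h0, if_true]; exact hI t ht
      by_cases h1 : i = m + 1
      · subst h1
        simp only [h0, if_false, if_true]; exact hEn t ht
      · simp only [h0, h1, if_false]; exact hEi i (by omega) (by omega) t ht
    · intro i hi
      have hi := Finset.mem_range.1 hi
      by_cases h0 : i = 0
      · simp only [h0, if_true]; exact hI0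
      · simp only [h0, if_false]; exact hE0 i (by omega) (by omega)
    · intro T hT i hi
      have hi := Finset.mem_range.1 hi
      by_cases h0 : i = 0
      · refine ⟨γ + μ, fun t h1 h2 h3 => ?_⟩
        simp only [h0, if_true]
        have : 0 ≤ ∑ i ∈ Finset.range (m+1), p i * lam (i + 1) * E (i + 1) t := by
          apply Finset.sum_nonneg
          intro j hj
          have hj := Finset.mem_range.1 hj
          have h4 := h3 (j+1) (Finset.mem_range.2 (by omega))
          rw [if_neg (by omega)] at h4
          exact (mul_pos (hQ j (by omega)) h4).le
        linarith
      by_cases h1 : i = m + 1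
      · refine ⟨lam (m+1) + μ, fun t ht h2 h3 => ?_⟩
        have h4 := h3 0 (Finset.mem_range.2 (by omega))
        rw [if_pos rfl] at h4
        have h5 := mul_pos (mul_pos hβ (hSp t ht)) h4
        subst h1
        simp only [h0, if_true, if_false]
        linarith
      · refine ⟨lam i + μ, fun t ht h2 h3 => ?_⟩
        have h4 := h3 (i+1) (Finset.mem_range.2 (by omega))
        rw [if_neg (by omega)] at h4
        have h6 := hp i (by omega) (by omega)
        have h5 := mul_pos (mul_pos (sub_pos.2 h6.2) (hlam (i+1) (by omega) (by omega))) h4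
        simp only [h0, h1, if_false]
        linarith
  have hIp : ∀ t, 0 ≤ t → 0 < I t := fun t ht => by
    simpa using hEIp t ht 0 (Finset.mem_range.2 (by omega))
  have hEp : ∀ i, 1 ≤ i → i ≤ m + 1 → ∀ t, 0 ≤ t → 0 < E i t := fun i h1 h2 t ht => by
    have := hEIp t ht i (Finset.mem_range.2 (by omega))
    rwa [if_neg (by omega)] at this
  have hRp : ∀ t, 0 ≤ t → 0 < R t := by
    refine cx_pos1 R _ hR hRinit ?_
    intro T hT
    refine ⟨μ, fun t h1 h2 h3 => ?_⟩
    have := mul_pos hγ (hIp t h1)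
    linarith
  -- total population bound
  have hsum' : S 0 + (∑ j ∈ Finset.range (m+1), E (j+1) 0) + I 0 + R 0 = 1 := by
    rw [← hsum]
    congr 3
    rw [Finset.range_eq_Ico, Finset.sum_Ico_add' (fun j => E j 0) 0 (m+1) 1]
    rfl
  have hN : ∀ t, 0 ≤ t → 0 < 2 - (S t + (∑ j ∈ Finset.range (m+1), E (j+1) t) + I t + R t) := by
    refine cx_pos1 (fun t => 2 - (S t + (∑ j ∈ Finset.range (m+1), E (j+1) t) + I t + R t))
      (fun t => - (μ - μ * (S t + (∑ j ∈ Finset.range (m+1), E (j+1) t) + I t + R t))) ?_ ?_ ?_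
    · intro t ht
      have hs1 : HasDerivAt (fun t => ∑ j ∈ Finset.range m, E (j+1) t)
          (∑ j ∈ Finset.range m, ((1 - p (j+1)) * lam (j + 1 + 1) * E (j + 1 + 1) t
            - (lam (j+1) + μ) * E (j+1) t)) t := by
        apply HasDerivAt.fun_sum
        intro j hj
        have hj := Finset.mem_range.1 hj
        exact hEi (j+1) (by omega) (by omega) t ht
      have hs2 := hs1.add (hEn t ht)
      have hs3 := ((((hS t ht).add hs2).add (hI t ht)).add (hR t ht)).const_sub 2
      simp only [Finset.sum_range_succ _ m]
      refine HasDerivAt.congr_deriv hs3 ?_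
      have A := cx_abel m P Q (fun j => lam (j+1)) (fun j => E (j+1) t) (by simp [hQd, hp0])
        (fun j hj => by simp only [hPd, hQd]; ring)
      have hs4 : ∑ j ∈ Finset.range m, ((1 - p (j+1)) * lam (j + 1 + 1) * E (j + 1 + 1) t
            - (lam (j+1) + μ) * E (j+1) t) =
          ∑ j ∈ Finset.range m, (P j * E (j + 1 + 1) t - lam (j+1) * E (j+1) t)
          - μ * ∑ j ∈ Finset.range m, E (j+1) t := by
        rw [Finset.mul_sum, ← Finset.sum_sub_distrib]
        apply Finset.sum_congr rfl
        intro j _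
        simp only [hPd]
        ring
      rw [hs4]
      simp only [hQd] at A
      linarith
    · simp only [hsum']; norm_num
    · intro T hT
      refine ⟨μ, fun t h1 h2 h3 => ?_⟩
      linarith
  have hEnn : ∀ t, 0 ≤ t → ∀ j ∈ Finset.range (m+1), 0 ≤ E (j+1) t := fun t ht j hj => by
    have hj := Finset.mem_range.1 hj
    exact (hEp (j+1) (by omega) (by omega) t ht).le
  have hcore := cx_core m P Q k (fun j => Es (j+1)) μ β (γ + μ) Ss Is S I (fun j => E (j+1))
    hμ hβ hd hP hQ hk' (fun j hj => hEsp _ (by omega) (by omega)) hSs hIs e1 e2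
    (fun j hj => e3 (j+1) (by omega) (by omega)) e4 hS hEn
    (fun j hj => hEi (j+1) (by omega) (by omega)) hI
    (fun t ht => ⟨hSp t ht, by
      have := hN t ht; have := hIp t ht; have := hRp t ht
      have := Finset.sum_nonneg (hEnn t ht); linarith⟩)
    (fun t ht => ⟨hIp t ht, by
      have := hN t ht; have := hSp t ht; have := hRp t ht
      have := Finset.sum_nonneg (hEnn t ht); linarith⟩)
    (fun j hj t ht => ⟨hEp _ (by omega) (by omega) t ht, by
      have := hN t ht; have := hSp t ht; have := hRp t ht; have := hIp t ht
      have := Finset.single_le_sum (hEnn t ht) (Finset.mem_range.2 (by omega : j < m + 1))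
      linarith⟩)
  obtain ⟨hSl, hIl⟩ := hcore
  have hRs : 0 < γ * Is / μ := by positivity
  refine ⟨Ss, Es, Is, γ * Is / μ, ⟨e1, e2, e3, e4, by field_simp; ring⟩,
    ⟨hSs, hEsp, hIs, hRs⟩, rfl, rfl, ?_, hSl, ?_, hIl, ?_⟩
  · rintro S' E' I' R' ⟨f1, f2, f3, f4, f5⟩ ⟨g1, g2, g3, g4⟩
    simp only [Nat.add_sub_cancel] at f3
    obtain ⟨c, hc, hc0, hcs⟩ := cx_weights m P Q k 1 one_pos hP hQ hk'
    have u1 := cx_cm m P Q k c (fun j => Es (j+1)) β (γ + μ) 1 Ss Is hc0 hcs e2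
      (fun j hj => e3 (j+1) (by omega) (by omega)) e4
    have u2 := cx_cm m P Q k c (fun j => E' (j+1)) β (γ + μ) 1 S' I' hc0 hcs f2
      (fun j hj => f3 (j+1) (by omega) (by omega)) f4
    have hcm := hc m le_rfl
    have u1' : c m * β * Ss = γ + μ := mul_right_cancel₀ hIs.ne' (by linarith)
    have u2' : c m * β * S' = γ + μ := mul_right_cancel₀ g3.ne' (by linarith)
    have hSS : S' = Ss := mul_left_cancel₀ (mul_pos hcm hβ).ne' (u2'.trans u1'.symm)
    subst hSS
    have hII : I' = Is := mul_left_cancel₀ (mul_pos hβ g1).ne' (by linarith)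
    subst hII
    refine ⟨rfl, rfl, ?_, ?_⟩
    · rw [eq_div_iff hμ.ne']; linarith
    · have key : ∀ j, j ≤ m → E' (m + 1 - j) = Es (m + 1 - j) := by
        intro j
        induction j with
        | zero =>
          intro _
          have := hk (m+1) (by omega) le_rfl
          exact mul_left_cancel₀ this.ne' (by simp only [Nat.sub_zero]; linarith)
        | succ j ih =>
          intro hj
          have ih := ih (by omega)
          obtain ⟨i, hi⟩ : ∃ i, i = m + 1 - (j + 1) := ⟨_, rfl⟩
          have hi' : m + 1 - j = i + 1 := by omega
          rw [hi'] at ih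
          rw [← hi]
          have v1 := e3 i (by omega) (by omega)
          have v2 := f3 i (by omega) (by omega)
          rw [ih] at v2
          exact mul_left_cancel₀ (hk i (by omega) (by omega)).ne' (by linarith)
      intro i h1 h2
      have := key (m + 1 - i) (by omega)
      rwa [show m + 1 - (m + 1 - i) = i by omega] at this
  · have key : ∀ j, j ≤ m → Tendsto (E (m + 1 - j)) atTop (𝓝 (Es (m + 1 - j))) := by
      intro j
      induction j with
      | zero =>
        intro _
        refine cx_filter _ _ _ _ (hk (m+1) (by omega) le_rfl) hEn ?_
        have : (lam (m+1) + μ) * Es (m+1) = β * Ss * Is := by linarith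
        simp only [Nat.sub_zero]
        rw [this]
        exact (hSl.const_mul β).mul hIl
      | succ j ih =>
        intro hj
        have ih := ih (by omega)
        obtain ⟨i, hi⟩ : ∃ i, i = m + 1 - (j + 1) := ⟨_, rfl⟩
        have hi' : m + 1 - j = i + 1 := by omega
        rw [hi'] at ih
        rw [← hi]
        refine cx_filter _ _ _ _ (hk i (by omega) (by omega)) (hEi i (by omega) (by omega)) ?_
        have : (lam i + μ) * Es i = (1 - p i) * lam (i + 1) * Es (i + 1) := by
          have := e3 i (by omega) (by omega); linarith
        rw [this]
        exact ih.const_mul _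
    intro i h1 h2
    have := key (m + 1 - i) (by omega)
    rwa [show m + 1 - (m + 1 - i) = i by omega] at this
  · refine cx_filter _ _ _ _ hμ hR ?_
    have : μ * (γ * Is / μ) = γ * Is := by field_simp
    rw [this]
    exact hIl.const_mul _
end
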